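/- arXiv:2103.09370 — 4 statements merged into one kernel-verified Lean document; each statement's English description precedes it below -/
import Mathlib

section
/- Let M be a compact metric space. Then the locally flat Lipschitz functions on M separate points uniformly — i.e., there exists a constant C ∈ [1,∞) such that for every pair x, y ∈ M there is a C-Lipschitz locally flat function f : M → ℝ with f(x) − f(y) = d(x,y) — if and only if M is purely 1-unrectifiable. -/
open Metric Set MeasureTheory
open scoped ENNReal NNReal

/-- A Lipschitz function `f : M → ℝ` is *locally flat* if for every point `p` and every
`ε > 0` there is `δ > 0` such that `|f x - f y| ≤ ε * d(x,y)` whenever `x, y` are within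
distance `δ` of `p`. -/
def LocallyFlat {M : Type*} [MetricSpace M] (f : M → ℝ) : Prop :=
  ∀ p : M, ∀ ε : ℝ, 0 < ε → ∃ δ : ℝ, 0 < δ ∧ ∀ x y : M,
    dist x p < δ → dist y p < δ → |f x - f y| ≤ ε * dist x y

/-- A metric space `M` is *purely 1-unrectifiable* if for every `A ⊆ ℝ` and every Lipschitz
map `f : A → M`, the 1-dimensional Hausdorff measure of `f(A)` is zero. -/
def Purely1Unrectifiable (M : Type*) [MetricSpace M] [MeasurableSpace M] [BorelSpace M] :
    Prop :=
  ∀ (A : Set ℝ) (f : ℝ → M) (K : ℝ≥0), LipschitzOnWith K f A → μH[1] (f '' A) = 0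

lemma gap_aux {K : ℝ≥0} {Φ : ℝ → ℝ} (hΦ : LipschitzWith K Φ) {A : Set ℝ}
    (hA : volume (Φ '' A) = 0) {a b : ℝ} (hab : a ≤ b) :
    ENNReal.ofReal |Φ b - Φ a| ≤ K * volume (Icc a b \ A) := by
  have h1 : uIcc (Φ a) (Φ b) ⊆ Φ '' A ∪ Φ '' (Icc a b \ A) := by
    refine (intermediate_value_uIcc (hΦ.continuous.continuousOn)).trans ?_
    rw [uIcc_of_le hab, ← image_union]
    apply image_mono
    intro x hx
    by_cases h : x ∈ A
    · exact Or.inl h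
    · exact Or.inr ⟨hx, h⟩
  have h2 := hΦ.hausdorffMeasure_image_le (d := 1) zero_le_one (Icc a b \ A)
  rw [hausdorffMeasure_real, ENNReal.rpow_one] at h2
  calc ENNReal.ofReal |Φ b - Φ a| = volume (uIcc (Φ a) (Φ b)) := by rw [Real.volume_interval]
    _ ≤ volume (Φ '' A ∪ Φ '' (Icc a b \ A)) := measure_mono h1
    _ ≤ volume (Φ '' A) + volume (Φ '' (Icc a b \ A)) := measure_union_le _ _
    _ ≤ _ := by rw [hA, zero_add]; exact h2

lemma ext_closure {M : Type*} [MetricSpace M] [CompactSpace M] {A : Set ℝ} {f : ℝ → M} {K : ℝ≥0}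
    (hf : LipschitzOnWith K f A) :
    ∃ g : ℝ → M, LipschitzOnWith K g (closure A) ∧ EqOn g f A := by
  have hrel : ∀ z ∈ closure ((fun t => (t, f t)) '' A), ∀ w ∈ closure ((fun t => (t, f t)) '' A),
      dist z.2 w.2 ≤ K * dist z.1 w.1 := by
    intro z hz w hw
    have hcl : IsClosed {q : (ℝ × M) × (ℝ × M) | dist q.1.2 q.2.2 ≤ K * dist q.1.1 q.2.1} :=
      isClosed_le (by fun_prop) (by fun_prop)
    have : closure (((fun t => (t, f t)) '' A) ×ˢ ((fun t => (t, f t)) '' A)) ⊆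
        {q : (ℝ × M) × (ℝ × M) | dist q.1.2 q.2.2 ≤ K * dist q.1.1 q.2.1} := by
      apply closure_minimal _ hcl
      rintro ⟨_, _⟩ ⟨⟨t, ht, rfl⟩, ⟨s, hs, rfl⟩⟩
      exact hf.dist_le_mul t ht s hs
    rw [closure_prod_eq] at this
    exact this (mk_mem_prod hz hw)
  have hex : ∀ t ∈ closure A, ∃ p : M, (t, p) ∈ closure ((fun t => (t, f t)) '' A) := by
    intro t ht
    have h1 : IsClosed (Prod.fst '' closure ((fun t => (t, f t)) '' A)) :=
      isClosedMap_fst_of_compactSpace _ isClosed_closure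
    have h2 : A ⊆ Prod.fst '' closure ((fun t => (t, f t)) '' A) := by
      intro s hs
      exact ⟨(s, f s), subset_closure ⟨s, hs, rfl⟩, rfl⟩
    obtain ⟨⟨t', p⟩, hp, rfl⟩ := closure_minimal h2 h1 ht
    exact ⟨p, hp⟩
  have : Nonempty M := ⟨f 0⟩
  choose! g hg using hex
  refine ⟨g, LipschitzOnWith.of_dist_le_mul fun t ht s hs => hrel _ (hg t ht) _ (hg s hs), ?_⟩
  intro t ht
  have := hrel _ (hg t (subset_closure ht)) (t, f t) (subset_closure ⟨t, ht, rfl⟩)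
  simpa using this

lemma image_null {F : ℝ → ℝ} {A : Set ℝ} (h : ∀ x ∈ A, HasDerivWithinAt F 0 A x) :
    volume (F '' A) = 0 := by
  refine addHaar_image_eq_zero_of_det_fderivWithin_eq_zero (f' := fun _ => 0) volume
    (fun x hx => ?_) (fun x hx => ?_)
  · have := (h x hx).hasFDerivWithinAt
    have h0 : ContinuousLinearMap.toSpanSingleton ℝ (0:ℝ) = 0 := by ext; simp
    rw [h0] at this
    exact this
  · simp [ContinuousLinearMap.det]

lemma flat_bound {M : Type*} [MetricSpace M] {A : Set ℝ} {g : ℝ → M} {K : ℝ≥0} {C : ℝ≥0}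
    (hg : LipschitzOnWith K g A) {f : M → ℝ} (hf : LipschitzWith C f) (hfl : LocallyFlat f)
    {a b : ℝ} (ha : a ∈ A) (hb : b ∈ A) (hab : a ≤ b) :
    ENNReal.ofReal |f (g b) - f (g a)| ≤ (C * K : ℝ≥0) * volume (Icc a b \ A) := by
  obtain ⟨F, hF, hFe⟩ := (hf.comp_lipschitzOnWith hg).extend_real
  rw [show f (g b) = F b from hFe hb, show f (g a) = F a from hFe ha]
  apply gap_aux hF _ hab
  apply image_null
  intro x hx
  rw [hasDerivWithinAt_iff_isLittleO, Asymptotics.isLittleO_iff]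
  intro ε hε
  obtain ⟨δ, hδ, h⟩ := hfl (g x) (ε / (K + 1)) (by positivity)
  have hball : Metric.ball x (δ / (K + 1)) ∩ A ∈ nhdsWithin x A := by
    rw [Set.inter_comm]
    exact inter_mem_nhdsWithin _ (Metric.ball_mem_nhds _ (by positivity))
  filter_upwards [hball] with y hy
  obtain ⟨hy1, hy2⟩ := hy
  have hl := hg.dist_le_mul y hy2 x hx
  rw [Metric.mem_ball, lt_div_iff₀ (by positivity)] at hy1
  have hd := dist_nonneg (x := y) (y := x)
  have h3 := h (g y) (g x) (by nlinarith) (by simpa using hδ)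
  rw [← show f (g y) = F y from hFe hy2, ← show f (g x) = F x from hFe hx]
  simp only [smul_zero, sub_zero, Real.norm_eq_abs]
  refine h3.trans ?_
  rw [← Real.dist_eq]
  calc ε / (K + 1) * dist (g y) (g x) ≤ ε / (K + 1) * ((K + 1) * dist y x) := by
        gcongr; nlinarith
    _ = ε * dist y x := by field_simp

lemma backward {M : Type*} [MetricSpace M] [CompactSpace M] [MeasurableSpace M] [BorelSpace M]
    (h : ∃ C : ℝ, 1 ≤ C ∧ ∀ x y : M, ∃ f : M → ℝ,
        LipschitzWith (Real.toNNReal C) f ∧ LocallyFlat f ∧ f x - f y = dist x y) :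
      Purely1Unrectifiable M := by
  obtain ⟨C, hC, h⟩ := h
  intro A0 g0 K hg0
  obtain ⟨g, hg, hge⟩ := ext_closure hg0
  have hAc : IsClosed (closure A0) := isClosed_closure
  suffices μH[1] (g '' closure A0) = 0 by
    refine measure_mono_null ?_ this
    rw [← image_congr hge]
    exact image_mono subset_closure
  generalize closure A0 = A at *
  set L : ℝ≥0 := Real.toNNReal C * K
  set ψ : ℝ → ℝ := fun t => ∫ s in (0:ℝ)..t, Aᶜ.indicator (fun _ => (1:ℝ)) s with hψ
  have hloc : LocallyIntegrable (Aᶜ.indicator (fun _ => (1:ℝ))) volume :=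
    (locallyIntegrable_const (1:ℝ)).indicator hAc.measurableSet.compl
  have hint : ∀ a b, IntervalIntegrable (Aᶜ.indicator (fun _ => (1:ℝ))) volume a b :=
    fun a b => (hloc.integrableOn_isCompact isCompact_uIcc).intervalIntegrable
  have hdiff : ∀ a b, a ≤ b → ψ b - ψ a = volume.real (Icc a b \ A) := by
    intro a b hab
    simp only [hψ]
    rw [intervalIntegral.integral_interval_sub_left (hint _ _) (hint _ _),
      intervalIntegral.integral_of_le hab, ← integral_Icc_eq_integral_Ioc,
      setIntegral_indicator hAc.measurableSet.compl]
    simp [sdiff_eq]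
  have hb1 : ∀ a ∈ A, ∀ b ∈ A, a ≤ b → dist (g a) (g b) ≤ L * dist (ψ a) (ψ b) := by
    intro a ha b hb hab
    obtain ⟨f, hf, hfl, hfe⟩ := h (g b) (g a)
    have := flat_bound hg hf hfl ha hb hab
    have hfin : volume (Icc a b \ A) ≠ ∞ :=
      ((measure_mono sdiff_subset).trans_lt (by simp : volume (Icc a b) < ∞)).ne
    rw [hfe, abs_of_nonneg dist_nonneg, ← ENNReal.ofReal_toReal hfin, ← ENNReal.ofReal_coe_nnreal,
      ← ENNReal.ofReal_mul (by positivity), ENNReal.ofReal_le_ofReal_iff (by positivity)] at this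
    rw [dist_comm, dist_comm (ψ a), Real.dist_eq, hdiff a b hab, abs_of_nonneg measureReal_nonneg]
    exact this
  have hb2 : ∀ a ∈ A, ∀ b ∈ A, dist (g a) (g b) ≤ L * dist (ψ a) (ψ b) := by
    intro a ha b hb
    rcases le_total a b with hab | hab
    · exact hb1 a ha b hb hab
    · rw [dist_comm, dist_comm (ψ a)]; exact hb1 b hb a ha hab
  set A1 : Set ℝ := {x ∈ A | HasDerivAt ψ 0 x}
  have hA2 : volume (A \ A1) = 0 := by
    have := LocallyIntegrable.ae_hasDerivAt_integral hloc
    rw [ae_iff] at this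
    refine measure_mono_null ?_ this
    rintro x ⟨hx, hx1⟩ hx2
    apply hx1
    refine ⟨hx, ?_⟩
    have := hx2 0
    simpa [hx] using this
  have h2 : μH[1] (g '' (A \ A1)) = 0 := by
    have := (hg.mono (sdiff_subset (t := A1))).hausdorffMeasure_image_le (d := 1) zero_le_one
    rw [hausdorffMeasure_real, hA2] at this
    simpa using this
  have h1 : μH[1] (g '' A1) = 0 := by
    set i := Function.invFunOn ψ A1
    have hi : ∀ t ∈ A1, i (ψ t) ∈ A1 ∧ ψ (i (ψ t)) = ψ t := fun t ht =>
      ⟨Function.invFunOn_mem ⟨t, ht, rfl⟩, Function.invFunOn_eq ⟨t, ht, rfl⟩⟩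
    have hlip : LipschitzOnWith L (g ∘ i) (ψ '' A1) := by
      apply LipschitzOnWith.of_dist_le_mul
      rintro _ ⟨t, ht, rfl⟩ _ ⟨s, hs, rfl⟩
      have := hb2 _ (hi t ht).1.1 _ (hi s hs).1.1
      rwa [(hi t ht).2, (hi s hs).2] at this
    have heq : g '' A1 ⊆ (g ∘ i) '' (ψ '' A1) := by
      rintro _ ⟨t, ht, rfl⟩
      refine ⟨ψ t, ⟨t, ht, rfl⟩, ?_⟩
      have := hb2 _ (hi t ht).1.1 _ ht.1
      rw [(hi t ht).2] at this
      simpa using this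
    refine measure_mono_null heq ?_
    have := hlip.hausdorffMeasure_image_le (d := 1) zero_le_one
    rw [hausdorffMeasure_real, image_null (fun x hx => hx.2.hasDerivWithinAt)] at this
    simpa using this
  refine measure_mono_null ?_ (measure_union_null h1 h2)
  rw [← image_union]
  apply image_mono
  intro x hx
  by_cases hh : x ∈ A1
  · exact Or.inl hh
  · exact Or.inr ⟨hx, hh⟩

structure GoodMet {M : Type*} [MetricSpace M] (ρ : M → M → ℝ) : Prop where
  symm : ∀ x y, ρ x y = ρ y x
  tri : ∀ x y z, ρ x z ≤ ρ x y + ρ y z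
  le : ∀ x y, ρ x y ≤ dist x y
  low : ∃ c : ℝ≥0, 0 < c ∧ ∀ x y, dist x y ≤ c * ρ x y

lemma GoodMet.nonneg {M : Type*} [MetricSpace M] {ρ : M → M → ℝ} (h : GoodMet ρ) (x y : M) :
    0 ≤ ρ x y := by
  obtain ⟨c, hc, h⟩ := h.low
  have h1 : (0:ℝ) < c := hc
  have := dist_nonneg.trans (h x y)
  exact nonneg_of_mul_nonneg_right this h1

lemma GoodMet.self {M : Type*} [MetricSpace M] {ρ : M → M → ℝ} (h : GoodMet ρ) (x : M) :
    ρ x x = 0 := le_antisymm (by simpa using h.le x x) (h.nonneg x x)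

inductive Ch {M : Type*} (c : M → M → ℝ) (u : M) : M → ℝ → Prop
  | nil : Ch c u u 0
  | snoc (v w : M) (r : ℝ) : Ch c u v r → Ch c u w (r + c v w)

lemma Ch.trans {M : Type*} {c : M → M → ℝ} {u v w : M} {r s : ℝ} (h1 : Ch c u v r)
    (h2 : Ch c v w s) : Ch c u w (r + s) := by
  induction h2 with
  | nil => simpa using h1
  | snoc v' w' r' _ ih => rw [← add_assoc]; exact Ch.snoc _ _ _ ih

lemma Ch.symm {M : Type*} {c : M → M → ℝ} (hc : ∀ x y, c x y = c y x) {u v : M} {r : ℝ}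
    (h1 : Ch c u v r) : Ch c v u r := by
  induction h1 with
  | nil => exact Ch.nil
  | snoc v' w' r' _ ih =>
    have h0 : Ch c w' v' (0 + c w' v') := Ch.snoc _ _ _ Ch.nil
    have := h0.trans ih
    rw [zero_add, add_comm, hc w' v'] at this
    exact this

lemma Ch.lower {M : Type*} {c σ : M → M → ℝ} (h0 : ∀ x, σ x x ≤ 0)
    (ht : ∀ x y z, σ x z ≤ σ x y + σ y z) (hc : ∀ x y, σ x y ≤ c x y) {u v : M} {r : ℝ}
    (h1 : Ch c u v r) : σ u v ≤ r := by
  induction h1 with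
  | nil => exact h0 _
  | snoc v' w' r' _ ih => linarith [ht u v' w', hc v' w']

open Classical in
noncomputable def cst {M : Type*} (ρ : M → M → ℝ) (δ : ℝ) (x y : M) : ℝ :=
  if ρ x y ≤ δ then ρ x y / 2 else ρ x y

lemma chain_graph {M : Type*} [MetricSpace M] {ρ : M → M → ℝ} (hρ : GoodMet ρ) {δ : ℝ}
    {u v : M} {r : ℝ} (h : Ch (cst ρ δ) u v r) :
    ∃ (G : Set (ℝ × M)) (T : ℝ), 0 ≤ T ∧ (0, u) ∈ G ∧ (T, v) ∈ G ∧
      (∀ z ∈ G, 0 ≤ z.1 ∧ z.1 ≤ T) ∧ (∀ z ∈ G, ∀ w ∈ G, ρ z.2 w.2 ≤ |z.1 - w.1|) ∧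
      T ≤ 2 * r ∧ volume (Icc 0 T \ cthickening δ (Prod.fst '' G)) ≤ ENNReal.ofReal r := by
  induction h with
  | nil =>
    refine ⟨{(0, u)}, 0, le_rfl, rfl, rfl, ?_, ?_, by simp, ?_⟩
    · rintro _ rfl; simp
    · rintro _ rfl _ rfl; simp [hρ.self]
    · refine (measure_mono sdiff_subset).trans ?_
      simp
  | snoc v w r _ ih =>
    obtain ⟨G, T, hT, h0, hv, hb, hl, hr, hvol⟩ := ih
    have hn := hρ.nonneg v w
    have hcst : ρ v w / 2 ≤ cst ρ δ v w := by
      unfold cst; split_ifs <;> linarith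
    refine ⟨insert (T + ρ v w, w) G, T + ρ v w, by linarith, Or.inr h0, Or.inl rfl, ?_, ?_, ?_, ?_⟩
    · rintro z (rfl | hz)
      · exact ⟨by simp only; linarith, le_rfl⟩
      · exact ⟨(hb z hz).1, by linarith [(hb z hz).2]⟩
    · have key : ∀ z ∈ G, ρ z.2 w ≤ |z.1 - (T + ρ v w)| := by
        intro z hz
        have h1 := hl z hz _ hv
        have h2 := hb z hz
        have h3 := hρ.tri z.2 v w
        simp only at h1
        rw [abs_sub_comm, abs_of_nonneg (by linarith)] at h1 ⊢
        linarith
      rintro z (rfl | hz) z' (rfl | hz')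
      · simp [hρ.self]
      · rw [hρ.symm, abs_sub_comm]; exact key _ hz'
      · exact key _ hz
      · exact hl _ hz _ hz'
    · linarith
    · have hsub : cthickening δ (Prod.fst '' G) ⊆
          cthickening δ (Prod.fst '' insert (T + ρ v w, w) G) :=
        cthickening_subset_of_subset _ (image_mono (subset_insert _ _))
      rw [ENNReal.ofReal_add (by linarith) (by linarith)]
      have hlast : volume (Icc T (T + ρ v w) \ cthickening δ (Prod.fst '' insert (T + ρ v w, w) G))
          ≤ ENNReal.ofReal (cst ρ δ v w) := by
        by_cases hδ : ρ v w ≤ δ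
        · have : Icc T (T + ρ v w) \ cthickening δ (Prod.fst '' insert (T + ρ v w, w) G) = ∅ := by
            rw [sdiff_eq_empty]
            intro t ht
            refine mem_cthickening_of_dist_le t T δ _ ⟨(T, v), Or.inr hv, rfl⟩ ?_
            rw [Real.dist_eq, abs_of_nonneg (by linarith [ht.1])]
            linarith [ht.2]
          rw [this]; simp
        · refine (measure_mono sdiff_subset).trans ?_
          simp [cst, hδ]
      refine le_trans (measure_mono ?_) ((measure_union_le _ _).trans (add_le_add hvol hlast))
      rintro t ⟨ht, ht'⟩
      rcases le_total t T with h | h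
      · exact Or.inl ⟨⟨ht.1, h⟩, fun hh => ht' (hsub hh)⟩
      · exact Or.inr ⟨⟨h, ht.2⟩, ht'⟩

/-- The limit curve estimate. -/
lemma limit_bound {M : Type*} [MetricSpace M] [MeasurableSpace M] [BorelSpace M]
    (hM : Purely1Unrectifiable M) {ρ : M → M → ℝ} (hρ : GoodMet ρ)
    {G : Set (ℝ × M)} {T : ℝ} {u v : M} (hT : 0 ≤ T) (h0 : (0, u) ∈ G) (hv : (T, v) ∈ G)
    (hl : ∀ z ∈ G, ∀ w ∈ G, ρ z.2 w.2 ≤ |z.1 - w.1|) :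
    ENNReal.ofReal (ρ u v) ≤ volume (Icc 0 T \ (Prod.fst '' G)) := by
  have hex : ∀ t ∈ Prod.fst '' G, ∃ p, (t, p) ∈ G := by
    rintro _ ⟨⟨t, p⟩, h, rfl⟩; exact ⟨p, h⟩
  have : Nonempty M := ⟨u⟩
  choose! g hg using hex
  set A := Prod.fst '' G with hA
  obtain ⟨c, hc, hlow⟩ := hρ.low
  have hgl : LipschitzOnWith c g A := by
    apply LipschitzOnWith.of_dist_le_mul
    intro t ht s hs
    refine (hlow _ _).trans ?_
    gcongr
    exact hl _ (hg t ht) _ (hg s hs)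
  have hnull := hM A g c hgl
  have hρu : ∀ p q, |ρ u p - ρ u q| ≤ ρ p q := by
    intro p q
    rw [abs_le]
    constructor
    · linarith [hρ.tri u p q]
    · linarith [hρ.tri u q p, hρ.symm p q]
  have hlip : LipschitzWith 1 (ρ u) := LipschitzWith.of_dist_le_mul fun p q => by
    rw [Real.dist_eq, NNReal.coe_one, one_mul]
    exact (hρu p q).trans (hρ.le p q)
  have hφ : LipschitzOnWith 1 (fun t => ρ u (g t)) A := by
    apply LipschitzOnWith.of_dist_le_mul
    intro t ht s hs
    rw [Real.dist_eq, NNReal.coe_one, one_mul]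
    exact (hρu _ _).trans (hl _ (hg t ht) _ (hg s hs))
  obtain ⟨Φ, hΦ, hΦe⟩ := hφ.extend_real
  have hΦnull : volume (Φ '' A) = 0 := by
    rw [← image_congr hΦe, show (fun t => ρ u (g t)) '' A = ρ u '' (g '' A) from (image_image _ _ _).symm]
    have := hlip.hausdorffMeasure_image_le (d := 1) zero_le_one (g '' A)
    rw [hausdorffMeasure_real, hnull] at this
    simpa using this
  have h0A : (0:ℝ) ∈ A := ⟨_, h0, rfl⟩
  have hTA : T ∈ A := ⟨_, hv, rfl⟩
  have h1 : Φ 0 = 0 := by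
    rw [← hΦe h0A]
    have := hl _ h0 _ (hg 0 h0A)
    simp only [sub_self, abs_zero] at this
    exact le_antisymm this (hρ.nonneg _ _)
  have h2 : Φ T = ρ u v := by
    rw [← hΦe hTA]
    have h3 := hl _ (hg T hTA) _ hv
    simp only [sub_self, abs_zero] at h3
    have := (hρu (g T) v).trans h3
    exact sub_eq_zero.1 (abs_nonpos_iff.1 this)
  have := gap_aux hΦ hΦnull hT
  rw [h1, h2, sub_zero, abs_of_nonneg (hρ.nonneg _ _)] at this
  simpa using this

lemma key_delta {M : Type*} [MetricSpace M] [CompactSpace M] [MeasurableSpace M] [BorelSpace M]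
    (hM : Purely1Unrectifiable M) {ρ : M → M → ℝ} (hρ : GoodMet ρ) {η : ℝ} (hη : 0 < η) :
    ∃ δ : ℝ, 0 < δ ∧ ∀ u v r, Ch (cst ρ δ) u v r → ρ u v - η ≤ r := by
  by_contra hcon
  push Not at hcon
  have hpos : ∀ n : ℕ, (0:ℝ) < 1 / ((n:ℝ) + 1) := fun n => by positivity
  have hcon' := fun n : ℕ => hcon (1 / ((n:ℝ) + 1)) (hpos n)
  choose un vn rn hch hlt using hcon'
  have hgr := fun n => chain_graph hρ (hch n)
  choose Gn Tn hT0 h0 hv hb hl hTr hvol using hgr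
  obtain ⟨D, hD⟩ : ∃ D : ℝ, ∀ x y : M, dist x y ≤ D :=
    ⟨Metric.diam (univ : Set M), fun x y =>
      Metric.dist_le_diam_of_mem isCompact_univ.isBounded (mem_univ _) (mem_univ _)⟩
  have hTD : ∀ n, Tn n ≤ 2 * D := fun n => by
    linarith [hTr n, hlt n, hρ.le (un n) (vn n), hD (un n) (vn n)]
  have hr0 : ∀ n, 0 ≤ rn n := fun n => by linarith [hT0 n, hTr n]
  let U : Ultrafilter ℕ := Filter.hyperfilter ℕ
  have hUle : (U : Filter ℕ) ≤ Filter.atTop := by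
    rw [← Nat.cofinite_eq_atTop]; exact Filter.hyperfilter_le_cofinite
  have hS : IsCompact (Icc (0:ℝ) (2 * D) ×ˢ (univ : Set M)) := isCompact_Icc.prod isCompact_univ
  -- ultralimits of points
  have hlim : ∀ z : ℕ → ℝ × M, (∀ n, z n ∈ Icc (0:ℝ) (2 * D) ×ˢ (univ : Set M)) →
      ∃ p, Filter.Tendsto z U (nhds p) := by
    intro z hz
    obtain ⟨p, _, hp⟩ := hS.ultrafilter_le_nhds (U.map z) (by
      rw [Filter.le_principal_iff]
      exact Filter.mem_map.2 (Filter.univ_mem' hz))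
    exact ⟨p, hp⟩
  have hmemS : ∀ n, ∀ z ∈ Gn n, z ∈ Icc (0:ℝ) (2 * D) ×ˢ (univ : Set M) := fun n z hz =>
    ⟨⟨(hb n z hz).1, (hb n z hz).2.trans (hTD n)⟩, mem_univ _⟩
  let G : Set (ℝ × M) := {z | ∀ ε > 0, ∀ᶠ n in (U : Filter ℕ), ∃ w ∈ Gn n, dist w z < ε}
  have hGlim : ∀ z : ℕ → ℝ × M, (∀ n, z n ∈ Gn n) → ∀ p, Filter.Tendsto z U (nhds p) → p ∈ G := by
    intro z hz p hp ε hε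
    filter_upwards [Metric.tendsto_nhds.1 hp ε hε] with n hn
    exact ⟨z n, hz n, hn⟩
  have hGcl : IsClosed G := by
    rw [← isOpen_compl_iff, Metric.isOpen_iff]
    intro z hz
    have hz' : ¬ ∀ ε > 0, ∀ᶠ n in (U : Filter ℕ), ∃ w ∈ Gn n, dist w z < ε := hz
    simp only [not_forall] at hz'
    obtain ⟨ε, hε, hz'⟩ := hz'
    refine ⟨ε / 2, by positivity, fun y hy hyG => hz' ?_⟩
    filter_upwards [hyG (ε / 2) (by positivity)] with n hn
    obtain ⟨w, hw, hwy⟩ := hn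
    refine ⟨w, hw, ?_⟩
    rw [Metric.mem_ball] at hy
    linarith [dist_triangle w y z]
  have hGS : G ⊆ Icc (0:ℝ) (2 * D) ×ˢ (univ : Set M) := by
    intro z hz
    rw [← hS.isClosed.closure_eq, Metric.mem_closure_iff]
    intro ε hε
    obtain ⟨n, w, hw, hwz⟩ := (hz ε hε).exists
    exact ⟨w, hmemS n w hw, by rwa [dist_comm]⟩
  have hGc : IsCompact G := hS.of_isClosed_subset hGcl hGS
  have hup : ∀ ζ > 0, ∀ᶠ n in (U : Filter ℕ), ∀ z ∈ Gn n, ∃ w ∈ G, dist z w < ζ := by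
    intro ζ hζ
    by_contra hc
    rw [← Ultrafilter.eventually_not] at hc
    have hz : ∀ n, ∃ z ∈ Gn n, (¬ ∀ z ∈ Gn n, ∃ w ∈ G, dist z w < ζ) → ∀ w ∈ G, ζ ≤ dist z w := by
      intro n
      by_cases h : ∀ z ∈ Gn n, ∃ w ∈ G, dist z w < ζ
      · exact ⟨_, h0 n, fun h' => absurd h h'⟩
      · push Not at h
        obtain ⟨z, hz, h⟩ := h
        exact ⟨z, hz, fun _ => h⟩
    choose z hz hz' using hz
    obtain ⟨p, hp⟩ := hlim z fun n => hmemS n _ (hz n)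
    have hpG := hGlim z hz p hp
    obtain ⟨n, h1, h2⟩ := (hc.and (Metric.tendsto_nhds.1 hp ζ hζ)).exists
    exact absurd (hz' n h1 p hpG) (not_le.2 h2)
  have hGl : ∀ z ∈ G, ∀ w ∈ G, ρ z.2 w.2 ≤ |z.1 - w.1| := by
    intro z hz w hw
    apply le_of_forall_pos_le_add
    intro ε hε
    obtain ⟨n, ⟨z', hz', hzz⟩, ⟨w', hw', hww⟩⟩ :=
      ((hz (ε / 4) (by positivity)).and (hw (ε / 4) (by positivity))).exists
    have h1 := hl n z' hz' w' hw'
    rw [Prod.dist_eq, max_lt_iff] at hzz hww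
    have h2 := hρ.tri z.2 z'.2 w.2
    have h3 := hρ.tri z'.2 w'.2 w.2
    have h4 := hρ.le z.2 z'.2
    rw [dist_comm] at h4
    have h5 := hρ.le w'.2 w.2
    have h6 := hzz.1
    have h7 := hww.1
    rw [Real.dist_eq] at h6 h7
    have h8 : |z'.1 - w'.1| ≤ |z'.1 - z.1| + |z.1 - w.1| + |w'.1 - w.1| := by
      rw [abs_sub_comm w'.1 w.1]
      have : z'.1 - w'.1 = (z'.1 - z.1) + (z.1 - w.1) + (w.1 - w'.1) := by ring
      rw [this]
      exact abs_add_three _ _ _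
    linarith [hzz.2, hww.2]
  obtain ⟨⟨o, u⟩, hou⟩ := hlim (fun n => (0, un n)) fun n => hmemS n _ (h0 n)
  obtain ⟨⟨T, v⟩, hTv⟩ := hlim (fun n => (Tn n, vn n)) fun n => hmemS n _ (hv n)
  have ho : o = 0 := by
    have h1 : Filter.Tendsto (fun _ : ℕ => (0:ℝ)) U (nhds o) :=
      (continuous_fst.tendsto _).comp hou
    exact tendsto_nhds_unique h1 tendsto_const_nhds
  subst ho
  have huG : ((0:ℝ), u) ∈ G := hGlim _ h0 _ hou
  have hvG : (T, v) ∈ G := hGlim _ hv _ hTv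
  have hT : 0 ≤ T := (hGS hvG).1.1
  have hmain := limit_bound hM hρ hT huG hvG hGl
  set A : Set ℝ := Prod.fst '' G with hA
  have hAc : IsClosed A := (hGc.image continuous_fst).isClosed
  have hev : ∀ ε > 0, ∀ᶠ n in (U : Filter ℕ), |Tn n - T| < ε ∧ |ρ (un n) (vn n) - ρ u v| < ε := by
    intro ε hε
    filter_upwards [Metric.tendsto_nhds.1 hou (ε / 2) (by positivity),
      Metric.tendsto_nhds.1 hTv (ε / 2) (by positivity)] with n h1 h2
    rw [Prod.dist_eq, max_lt_iff] at h1 h2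
    have h3 := h1.2
    have h4 := h2.1
    have h5 := h2.2
    simp only at h3 h4 h5
    rw [Real.dist_eq] at h4
    refine ⟨by linarith, ?_⟩
    have a1 := hρ.tri (un n) u (vn n)
    have a2 := hρ.tri u v (vn n)
    have a3 := hρ.tri u (un n) v
    have a4 := hρ.tri (un n) (vn n) v
    have b1 := hρ.le (un n) u
    have b2 := hρ.le (vn n) v
    rw [hρ.symm u (un n)] at a3
    rw [hρ.symm v (vn n)] at a2
    rw [abs_lt]
    constructor <;> linarith
  have hζ : ∀ ζ > 0, volume (Icc 0 T \ cthickening ζ A) ≤ ENNReal.ofReal (ρ u v - η / 2) := by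
    intro ζ hζ
    have hδ : ∀ᶠ n : ℕ in (U : Filter ℕ), 1 / ((n:ℝ) + 1) < ζ / 2 :=
      hUle ((tendsto_order.1 tendsto_one_div_add_atTop_nhds_zero_nat).2 _ (by positivity))
    obtain ⟨n, ⟨h1, h2⟩, h3, h4⟩ :=
      ((hev (η / 4) (by positivity)).and ((hup (ζ / 2) (by positivity)).and hδ)).exists
    have hsub : cthickening (1 / ((n:ℝ) + 1)) (Prod.fst '' Gn n) ⊆ cthickening ζ A := by
      have : Prod.fst '' Gn n ⊆ cthickening (ζ / 2) A := by
        rintro _ ⟨z, hz, rfl⟩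
        obtain ⟨w, hw, hzw⟩ := h3 z hz
        refine mem_cthickening_of_dist_le z.1 w.1 _ _ ⟨w, hw, rfl⟩ ?_
        rw [Prod.dist_eq, max_lt_iff] at hzw
        exact hzw.1.le
      refine (cthickening_subset_of_subset _ this).trans ?_
      refine (cthickening_cthickening_subset (hpos n).le (by positivity) _).trans ?_
      exact cthickening_mono (by linarith) _
    rw [abs_lt] at h1 h2
    calc volume (Icc 0 T \ cthickening ζ A)
        ≤ volume ((Icc 0 (Tn n) \ cthickening (1 / ((n:ℝ) + 1)) (Prod.fst '' Gn n)) ∪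
            Icc (Tn n) T) := by
          apply measure_mono
          rintro t ⟨ht, ht'⟩
          rcases le_total t (Tn n) with h | h
          · exact Or.inl ⟨⟨ht.1, h⟩, fun hh => ht' (hsub hh)⟩
          · exact Or.inr ⟨h, ht.2⟩
      _ ≤ ENNReal.ofReal (rn n) + ENNReal.ofReal (η / 4) := by
          refine (measure_union_le _ _).trans (add_le_add (hvol n) ?_)
          rw [Real.volume_Icc]
          exact ENNReal.ofReal_le_ofReal (by linarith)
      _ = ENNReal.ofReal (rn n + η / 4) := (ENNReal.ofReal_add (hr0 n) (by positivity)).symm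
      _ ≤ _ := ENNReal.ofReal_le_ofReal (by linarith [hlt n])
  have hfin : volume (Icc 0 T \ A) ≤ ENNReal.ofReal (ρ u v - η / 2) := by
    have hU : Icc 0 T \ A = ⋃ m : ℕ, Icc 0 T \ cthickening (1 / ((m:ℝ) + 1)) A := by
      ext t
      simp only [mem_sdiff, mem_iUnion]
      constructor
      · rintro ⟨ht, htA⟩
        rw [← hAc.closure_eq, closure_eq_iInter_cthickening] at htA
        simp only [mem_iInter, not_forall] at htA
        obtain ⟨ε, hε, hte⟩ := htA
        obtain ⟨m, hm⟩ := exists_nat_one_div_lt hε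
        exact ⟨m, ht, fun hh => hte (cthickening_mono hm.le _ hh)⟩
      · rintro ⟨m, ht, htm⟩
        exact ⟨ht, fun hh => htm (self_subset_cthickening _ hh)⟩
    have hmono : Monotone fun m : ℕ => Icc 0 T \ cthickening (1 / ((m:ℝ) + 1)) A := by
      intro m k hmk
      apply sdiff_subset_sdiff_right
      apply cthickening_mono
      exact Nat.one_div_le_one_div hmk
    rw [hU, hmono.measure_iUnion]
    exact iSup_le fun m => hζ _ (hpos m)
  obtain ⟨n, h1, h2⟩ := (hev (η / 4) (by positivity)).exists
  rw [abs_lt] at h2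
  have h3 := hr0 n
  have h4 := hlt n
  have h5 := hmain.trans hfin
  rw [ENNReal.ofReal_le_ofReal_iff (by linarith)] at h5
  linarith

lemma step_met {M : Type*} [MetricSpace M] [CompactSpace M] [MeasurableSpace M] [BorelSpace M]
    (hM : Purely1Unrectifiable M) {ρ : M → M → ℝ} (hρ : GoodMet ρ) {η : ℝ} (hη : 0 < η) :
    ∃ ρ' : M → M → ℝ, GoodMet ρ' ∧ (∀ x y, ρ' x y ≤ ρ x y) ∧ (∀ x y, ρ x y - η ≤ ρ' x y) ∧
      ∃ δ : ℝ, 0 < δ ∧ ∀ x y, dist x y ≤ δ → ρ' x y ≤ ρ x y / 2 := by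
  obtain ⟨δ, hδ, hk⟩ := key_delta hM hρ hη
  have hsym : ∀ x y, cst ρ δ x y = cst ρ δ y x := fun x y => by
    unfold cst; rw [hρ.symm x y]
  have hlow : ∀ u v r, Ch (cst ρ δ) u v r → ρ u v / 2 ≤ r := by
    intro u v r h
    refine Ch.lower (σ := fun x y => ρ x y / 2) (fun x => by simp [hρ.self]) (fun x y z => ?_)
      (fun x y => ?_) h
    · linarith [hρ.tri x y z]
    · have := hρ.nonneg x y
      simp only [cst]; split_ifs <;> linarith
  have hone : ∀ u v, Ch (cst ρ δ) u v (cst ρ δ u v) := fun u v => by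
    have := Ch.snoc (c := cst ρ δ) u v 0 Ch.nil
    rwa [zero_add] at this
  have hbdd : ∀ u v, BddBelow {r | Ch (cst ρ δ) u v r} := fun u v =>
    ⟨ρ u v / 2, fun r hr => hlow u v r hr⟩
  have hne : ∀ u v, {r | Ch (cst ρ δ) u v r}.Nonempty := fun u v => ⟨_, hone u v⟩
  have hcle : ∀ u v, cst ρ δ u v ≤ ρ u v := fun u v => by
    have := hρ.nonneg u v
    unfold cst; split_ifs <;> linarith
  have hle : ∀ u v, sInf {r | Ch (cst ρ δ) u v r} ≤ cst ρ δ u v := fun u v =>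
    csInf_le (hbdd u v) (hone u v)
  refine ⟨fun u v => sInf {r | Ch (cst ρ δ) u v r}, ⟨?_, ?_, ?_, ?_⟩, ?_, ?_, δ, hδ, ?_⟩
  · intro x y
    congr 1
    ext r
    exact ⟨fun h => h.symm hsym, fun h => h.symm hsym⟩
  · intro x y z
    apply le_of_forall_pos_le_add
    intro ε hε
    obtain ⟨r, hr, hr'⟩ := exists_lt_of_csInf_lt (hne x y)
      (lt_add_of_pos_right (sInf {r | Ch (cst ρ δ) x y r}) (half_pos hε))
    obtain ⟨s, hs, hs'⟩ := exists_lt_of_csInf_lt (hne y z)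
      (lt_add_of_pos_right (sInf {r | Ch (cst ρ δ) y z r}) (half_pos hε))
    have := csInf_le (hbdd x z) (Ch.trans hr hs)
    linarith
  · intro x y
    exact (hle x y).trans ((hcle x y).trans (hρ.le x y))
  · obtain ⟨c, hc, h⟩ := hρ.low
    refine ⟨2 * c, by positivity, fun x y => (h x y).trans ?_⟩
    have : ρ x y / 2 ≤ sInf {r | Ch (cst ρ δ) x y r} :=
      le_csInf (hne x y) fun r hr => hlow x y r hr
    push_cast
    have hc' : (0:ℝ) < c := hc
    nlinarith
  · intro x y
    exact (hle x y).trans (hcle x y)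
  · intro x y
    exact le_csInf (hne x y) fun r hr => hk x y r hr
  · intro x y hxy
    refine (hle x y).trans ?_
    unfold cst
    rw [if_pos ((hρ.le x y).trans hxy)]

lemma limit_met {M : Type*} [MetricSpace M] [CompactSpace M] [MeasurableSpace M] [BorelSpace M]
    (hM : Purely1Unrectifiable M) {η : ℝ} (hη : 0 < η) :
    ∃ ρ : M → M → ℝ, (∀ x y, 0 ≤ ρ x y) ∧ (∀ x y, ρ x y = ρ y x) ∧
      (∀ x y z, ρ x z ≤ ρ x y + ρ y z) ∧ (∀ x y, ρ x y ≤ dist x y) ∧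
      (∀ x y, dist x y - η ≤ ρ x y) ∧
      ∀ ε : ℝ, 0 < ε → ∃ δ : ℝ, 0 < δ ∧ ∀ x y, dist x y ≤ δ → ρ x y ≤ ε * dist x y := by
  have hgood : GoodMet (fun x y : M => dist x y) :=
    ⟨dist_comm, dist_triangle, fun _ _ => le_rfl, 1, one_pos, fun x y => by simp⟩
  have hst : ∀ (n : ℕ) (ρ : {ρ : M → M → ℝ // GoodMet ρ}), ∃ ρ' : {ρ : M → M → ℝ // GoodMet ρ},
      (∀ x y, ρ'.1 x y ≤ ρ.1 x y) ∧ (∀ x y, ρ.1 x y - η / 2 ^ (n + 1) ≤ ρ'.1 x y) ∧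
      ∃ δ : ℝ, 0 < δ ∧ ∀ x y, dist x y ≤ δ → ρ'.1 x y ≤ ρ.1 x y / 2 := by
    intro n ρ
    obtain ⟨ρ', h1, h2⟩ := step_met hM ρ.2 (show 0 < η / 2 ^ (n + 1) by positivity)
    exact ⟨⟨ρ', h1⟩, h2⟩
  choose F hF1 hF2 hF3 using hst
  let s : ℕ → {ρ : M → M → ℝ // GoodMet ρ} := fun n => Nat.rec ⟨_, hgood⟩ F n
  have hs : ∀ n, s (n + 1) = F n (s n) := fun n => rfl
  have hanti : ∀ x y, Antitone fun n => (s n).1 x y := fun x y =>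
    antitone_nat_of_succ_le fun n => by rw [hs]; exact hF1 _ _ x y
  have hbdd : ∀ x y, BddBelow (range fun n => (s n).1 x y) := fun x y =>
    ⟨0, by rintro _ ⟨n, rfl⟩; exact (s n).2.nonneg x y⟩
  have hlim : ∀ x y, Filter.Tendsto (fun n => (s n).1 x y) Filter.atTop
      (nhds (⨅ n, (s n).1 x y)) := fun x y => tendsto_atTop_ciInf (hanti x y) (hbdd x y)
  have hle : ∀ n x y, (⨅ n, (s n).1 x y) ≤ (s n).1 x y := fun n x y => ciInf_le (hbdd x y) n
  refine ⟨fun x y => ⨅ n, (s n).1 x y, fun x y => le_ciInf fun n => (s n).2.nonneg x y,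
    fun x y => ?_, fun x y z => ?_, fun x y => hle 0 x y, fun x y => ?_, fun ε hε => ?_⟩
  · exact congrArg _ (funext fun n => (s n).2.symm x y)
  · exact le_of_tendsto_of_tendsto' (hlim x z) ((hlim x y).add (hlim y z))
      fun n => (s n).2.tri x y z
  · have : ∀ n, dist x y - η * (1 - 1 / 2 ^ n) ≤ (s n).1 x y := by
      intro n
      induction n with
      | zero => simp [s]
      | succ n ih =>
        rw [hs]
        have := hF2 n (s n) x y
        have h2 : η * (1 - 1 / 2 ^ (n + 1)) = η * (1 - 1 / 2 ^ n) + η / 2 ^ (n + 1) := by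
          rw [pow_succ]; field_simp; ring
        linarith
    refine le_ciInf fun n => le_trans ?_ (this n)
    have : 0 ≤ η * (1 / 2 ^ n) := by positivity
    linarith
  · have : ∀ n : ℕ, ∃ δ : ℝ, 0 < δ ∧ ∀ x y, dist x y ≤ δ → (s n).1 x y ≤ (1 / 2) ^ n * dist x y := by
      intro n
      induction n with
      | zero => exact ⟨1, one_pos, fun x y _ => by simp [s]⟩
      | succ n ih =>
        obtain ⟨δ, hδ, h⟩ := ih
        obtain ⟨δ', hδ', h'⟩ := hF3 n (s n)
        refine ⟨min δ δ', lt_min hδ hδ', fun x y hxy => ?_⟩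
        have h1 := h x y (hxy.trans (min_le_left _ _))
        have h2 := h' x y (hxy.trans (min_le_right _ _))
        rw [hs, pow_succ]
        linarith
    obtain ⟨n, hn⟩ := exists_pow_lt_of_lt_one hε (show (1 / 2 : ℝ) < 1 by norm_num)
    obtain ⟨δ, hδ, h⟩ := this n
    refine ⟨δ, hδ, fun x y hxy => (hle n x y).trans ((h x y hxy).trans ?_)⟩
    gcongr

lemma forward {M : Type*} [MetricSpace M] [CompactSpace M] [MeasurableSpace M] [BorelSpace M]
    (hM : Purely1Unrectifiable M) : ∃ C : ℝ, 1 ≤ C ∧ ∀ x y : M, ∃ f : M → ℝ,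
        LipschitzWith (Real.toNNReal C) f ∧ LocallyFlat f ∧ f x - f y = dist x y := by
  refine ⟨2, by norm_num, fun x y => ?_⟩
  by_cases hxy : x = y
  · subst hxy
    refine ⟨fun _ => 0, LipschitzWith.const' 0, fun p ε hε => ⟨1, one_pos, fun a b _ _ => ?_⟩, by simp⟩
    simp only [sub_self, abs_zero]; positivity
  have hd : 0 < dist x y := dist_pos.2 hxy
  obtain ⟨ρ, hn, hs, ht, hle, hlow, hfl⟩ := limit_met hM (half_pos hd)
  have hρ : dist x y / 2 ≤ ρ x y := by linarith [hlow x y]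
  have hρ0 : 0 < ρ x y := by linarith
  set k := dist x y / ρ x y
  have hk0 : 0 ≤ k := by positivity
  have hk : k ≤ 2 := by
    rw [div_le_iff₀ hρ0]; linarith
  have hb : ∀ a b, |k * ρ a y - k * ρ b y| ≤ 2 * ρ a b := by
    intro a b
    rw [← mul_sub, abs_mul, abs_of_nonneg hk0]
    have : |ρ a y - ρ b y| ≤ ρ a b := by
      rw [abs_le]
      constructor
      · linarith [ht b a y, hs a b]
      · linarith [ht a b y]
    exact mul_le_mul hk this (abs_nonneg _) (by norm_num)
  refine ⟨fun z => k * ρ z y, ?_, ?_, ?_⟩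
  · apply LipschitzWith.of_dist_le_mul
    intro a b
    rw [Real.dist_eq, Real.coe_toNNReal _ (by norm_num)]
    linarith [hb a b, hle a b]
  · intro p ε hε
    obtain ⟨δ, hδ, h⟩ := hfl (ε / 2) (by positivity)
    refine ⟨δ / 2, by positivity, fun a b ha hb' => ?_⟩
    have := h a b (by linarith [dist_triangle_right a b p])
    linarith [hb a b]
  · have hyy : ρ y y = 0 := le_antisymm (by simpa using hle y y) (hn y y)
    simp only [hyy, mul_zero, sub_zero]
    exact div_mul_cancel₀ _ hρ0.ne'

/-- **Theorem A.** For a compact metric space `M`, the locally flat Lipschitz functions on `M`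
separate points uniformly if and only if `M` is purely 1-unrectifiable. -/
theorem locallyFlat_separate_points_uniformly_iff_purely1Unrectifiable
    {M : Type*} [MetricSpace M] [CompactSpace M] [MeasurableSpace M] [BorelSpace M] :
    (∃ C : ℝ, 1 ≤ C ∧ ∀ x y : M, ∃ f : M → ℝ,
        LipschitzWith (Real.toNNReal C) f ∧ LocallyFlat f ∧ f x - f y = dist x y) ↔
      Purely1Unrectifiable M := ⟨backward, forward⟩
end

section
/- If M is a compact purely 1-unrectifiable metric space, then for every p ∈ M and every δ > 0 there exists a 1-Lipschitz locally flat function g : M → ℝ such that g(x) − g(p) ≥ d(p,x) − δ for every x ∈ M. -/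
open Metric Set MeasureTheory
open scoped ENNReal NNReal

open Filter Topology

namespace LFlat

structure Good {M : Type*} [MetricSpace M] (D : M → M → ℝ) : Prop where
  self : ∀ x, D x x = 0
  symm : ∀ x y, D x y = D y x
  tri : ∀ x y z, D x z ≤ D x y + D y z
  le : ∀ x y, D x y ≤ dist x y
  lower : ∃ η : ℝ, 0 < η ∧ ∀ x y, η * dist x y ≤ D x y

variable {M : Type*} [MetricSpace M]

lemma Good.nonneg {D : M → M → ℝ} (h : Good D) (x y : M) : 0 ≤ D x y := by
  have h1 := h.tri x y x
  rw [h.self, h.symm y x] at h1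
  linarith

lemma Good.abs_sub {D : M → M → ℝ} (h : Good D) (p x y : M) : |D p x - D p y| ≤ D x y := by
  rw [abs_le]
  have h1 := h.tri p x y
  have h2 := h.tri p y x
  rw [h.symm y x] at h2
  constructor <;> linarith

noncomputable def phi (r t : ℝ) : ℝ := if t ≤ r then t / 2 else t

inductive Reach (D : M → M → ℝ) (r : ℝ) (p : M) : M → ℝ → Prop
  | refl : Reach D r p p 0
  | step {x : M} {c : ℝ} (y : M) (h : Reach D r p x c) : Reach D r p y (c + phi r (D x y))

lemma Reach.trans {D : M → M → ℝ} {r : ℝ} {x y z : M} {a b : ℝ}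
    (h1 : Reach D r x y a) (h2 : Reach D r y z b) : Reach D r x z (a + b) := by
  induction h2 with
  | refl => simpa using h1
  | step y h ih => rw [← add_assoc]; exact ih.step y

lemma Reach.symm {D : M → M → ℝ} (hD : Good D) {r : ℝ} {x y : M} {a : ℝ}
    (h1 : Reach D r x y a) : Reach D r y x a := by
  induction h1 with
  | refl => exact Reach.refl
  | @step z c y h ih =>
    have h2 : Reach D r y z (0 + phi r (D y z)) := Reach.refl.step z
    have h3 := h2.trans ih
    rw [hD.symm z y]
    convert h3 using 1
    ring

lemma phi_ge {r t : ℝ} (ht : 0 ≤ t) : t / 2 ≤ phi r t := by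
  unfold phi; split_ifs <;> linarith

lemma phi_le {r t : ℝ} (ht : 0 ≤ t) : phi r t ≤ t := by
  unfold phi; split_ifs <;> linarith

lemma Reach.lower {D : M → M → ℝ} (hD : Good D) {r : ℝ} {x y : M} {a : ℝ}
    (h1 : Reach D r x y a) : D x y / 2 ≤ a := by
  induction h1 with
  | refl => simp [hD.self]
  | @step z c y h ih =>
    have := phi_ge (r := r) (hD.nonneg z y)
    have := hD.tri x z y
    linarith

noncomputable def nD (D : M → M → ℝ) (r : ℝ) (x y : M) : ℝ := sInf {c | Reach D r x y c}

lemma reach_one (D : M → M → ℝ) (r : ℝ) (x y : M) : Reach D r x y (phi r (D x y)) := by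
  have : Reach D r x y (0 + phi r (D x y)) := Reach.refl.step y
  simpa using this

lemma nD_le {D : M → M → ℝ} (hD : Good D) {r : ℝ} {x y : M} {a : ℝ}
    (h1 : Reach D r x y a) : nD D r x y ≤ a :=
  csInf_le ⟨D x y / 2, fun _ h => Reach.lower hD h⟩ h1

lemma le_nD {D : M → M → ℝ} {r : ℝ} {x y : M} {a : ℝ}
    (h : ∀ c, Reach D r x y c → a ≤ c) : a ≤ nD D r x y :=
  le_csInf ⟨_, reach_one D r x y⟩ h

lemma nD_le_self {D : M → M → ℝ} (hD : Good D) (r : ℝ) (x y : M) : nD D r x y ≤ D x y :=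
  (nD_le hD (reach_one D r x y)).trans (phi_le (hD.nonneg x y))

lemma nD_good {D : M → M → ℝ} (hD : Good D) (r : ℝ) : Good (nD D r) where
  self x := by
    apply le_antisymm (nD_le hD Reach.refl)
    refine le_nD fun c hc => ?_
    have := Reach.lower hD hc
    rw [hD.self] at this
    linarith
  symm x y := by
    apply le_antisymm
    · exact le_nD fun c hc => nD_le hD (Reach.symm hD hc)
    · exact le_nD fun c hc => nD_le hD (Reach.symm hD hc)
  tri x y z := by
    have : nD D r x z - nD D r x y ≤ nD D r y z := by
      refine le_nD fun c hc => ?_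
      have : nD D r x z - c ≤ nD D r x y := by
        refine le_nD fun b hb => ?_
        have := nD_le hD (hb.trans hc)
        linarith
      linarith
    linarith
  le x y := (nD_le_self hD r x y).trans (hD.le x y)
  lower := by
    obtain ⟨η, h0, h⟩ := hD.lower
    refine ⟨η / 2, by positivity, fun x y => le_nD fun c hc => ?_⟩
    have := Reach.lower hD hc
    have := h x y
    linarith

/-- parametrised chain -/
structure Par (D : M → M → ℝ) (r : ℝ) (p x : M) (c L : ℝ) (A G : Set ℝ) (γ : ℝ → M) : Prop where
  L0 : 0 ≤ L
  Lc : L ≤ 2 * c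
  fin : A.Finite
  sub : A ⊆ Icc 0 L
  zero : 0 ∈ A
  last : L ∈ A
  g0 : γ 0 = p
  gL : γ L = x
  lip : ∀ s ∈ A, ∀ t ∈ A, D (γ s) (γ t) ≤ |s - t|
  vol : volume G ≤ ENNReal.ofReal c
  cov : ∀ t ∈ Icc 0 L, t ∉ G → ∃ a ∈ A, |a - t| ≤ r

lemma Reach.par {D : M → M → ℝ} (hD : Good D) {r : ℝ} (hr : 0 < r) {p x : M} {c : ℝ}
    (h : Reach D r p x c) : ∃ L A G γ, Par D r p x c L A G γ := by
  induction h with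
  | refl =>
    refine ⟨0, {0}, ∅, fun _ => p, ?_⟩
    constructor <;> simp [hD.self]
    exact hr.le
  | @step x c y h ih =>
    obtain ⟨L, A, G, γ, P⟩ := ih
    have h0 := hD.nonneg x y
    have hp := phi_ge (r := r) h0
    have hc : 0 ≤ c := by linarith [P.L0, P.Lc]
    rcases h0.eq_or_lt with h1 | h1
    · have hxy : x = y := by
        obtain ⟨η, hη, h⟩ := hD.lower
        have := h x y
        rw [← h1] at this
        have h3 : dist x y ≤ 0 := by
          by_contra hh
          push Not at hh
          have := mul_pos hη hh
          linarith
        exact dist_le_zero.1 h3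
      subst hxy
      have : phi r (D x x) = 0 := by rw [hD.self]; unfold phi; simp
      rw [this, add_zero]
      exact ⟨L, A, G, γ, P⟩
    · have hlt : ∀ s ∈ A, s < L + D x y := fun s hs => by linarith [(P.sub hs).2]
      have hup : ∀ s ∈ A, Function.update γ (L + D x y) y s = γ s := fun s hs =>
        Function.update_of_ne (hlt s hs).ne _ _
      have key : ∀ s ∈ A, D (γ s) y ≤ L + D x y - s := by
        intro s hs
        have h3 := hD.tri (γ s) x y
        have h4 := P.lip s hs L P.last
        rw [P.gL, abs_sub_comm, abs_of_nonneg (by linarith [(P.sub hs).2])] at h4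
        linarith
      refine ⟨L + D x y, insert (L + D x y) A, if D x y ≤ r then G else G ∪ Ioo L (L + D x y),
        Function.update γ (L + D x y) y, ?_⟩
      constructor
      · linarith [P.L0]
      · linarith [P.Lc]
      · exact P.fin.insert _
      · rintro s (rfl | hs)
        · exact ⟨by linarith [P.L0], le_rfl⟩
        · exact ⟨(P.sub hs).1, (hlt s hs).le⟩
      · exact mem_insert_of_mem _ P.zero
      · exact mem_insert _ _
      · rw [hup 0 P.zero, P.g0]
      · simp
      · rintro s (rfl | hs) t (rfl | ht)
        · simp [hD.self]
        · rw [hup t ht, Function.update_self, hD.symm]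
          exact (key t ht).trans (le_abs_self _)
        · rw [hup s hs, Function.update_self, abs_sub_comm]
          exact (key s hs).trans (le_abs_self _)
        · rw [hup s hs, hup t ht]
          exact P.lip s hs t ht
      · unfold phi
        split_ifs with hh
        · exact P.vol.trans (ENNReal.ofReal_le_ofReal (by linarith))
        · rw [ENNReal.ofReal_add hc h0]
          refine (measure_union_le _ _).trans (add_le_add P.vol ?_)
          simp
      · intro t ht htG
        by_cases htL : t ≤ L
        · have : t ∉ G := by
            intro hG
            apply htG
            split_ifs
            · exact hG
            · exact Or.inl hG
          obtain ⟨a, ha, hat⟩ := P.cov t ⟨ht.1, htL⟩ this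
          exact ⟨a, mem_insert_of_mem _ ha, hat⟩
        · push Not at htL
          refine ⟨L + D x y, mem_insert _ _, ?_⟩
          rw [abs_of_nonneg (by linarith [ht.2])]
          split_ifs at htG with hh
          · linarith
          · have : ¬ (t < L + D x y) := fun h5 => htG (Or.inr ⟨htL, h5⟩)
            linarith

lemma ultra_lim {X : Type*} [TopologicalSpace X] {K : Set X} (hK : IsCompact K)
    (U : Ultrafilter ℕ) (u : ℕ → X) (hu : ∀ n, u n ∈ K) : ∃ x ∈ K, Tendsto u U (𝓝 x) := by
  obtain ⟨x, hx, h⟩ := hK.ultrafilter_le_nhds (U.map u)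
    (by rw [le_principal_iff]; exact Filter.Eventually.of_forall (f := (U : Filter ℕ)) hu)
  exact ⟨x, hx, h⟩

lemma limit_step [CompactSpace M] [MeasurableSpace M] [BorelSpace M]
    (hM : Purely1Unrectifiable M) {D : M → M → ℝ} (hD : Good D) (p : M) (δ : ℝ) (hδ : 0 < δ)
    (r : ℕ → ℝ) (hr : Tendsto r atTop (𝓝 0)) (x : ℕ → M) (c L : ℕ → ℝ) (A G : ℕ → Set ℝ)
    (γ : ℕ → ℝ → M) (P : ∀ n, Par D (r n) p (x n) (c n) (L n) (A n) (G n) (γ n))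
    (hc : ∀ n, c n ≤ D p (x n) - δ) : False := by
  set U : Ultrafilter ℕ := Ultrafilter.of atTop with hU
  have hUle : (U : Filter ℕ) ≤ atTop := Ultrafilter.of_le _
  have hrU : Tendsto r U (𝓝 0) := hr.mono_left hUle
  obtain ⟨η, hη, hlow⟩ := hD.lower
  obtain ⟨xx, -, hxx⟩ := ultra_lim isCompact_univ U x (fun n => mem_univ _)
  have hDx : Tendsto (fun n => D p (x n)) U (𝓝 (D p xx)) := by
    rw [tendsto_iff_dist_tendsto_zero] at hxx ⊢
    refine squeeze_zero (fun _ => dist_nonneg) (fun n => ?_) hxx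
    rw [Real.dist_eq]
    exact (hD.abs_sub p _ _).trans (hD.le _ _)
  have hLb : ∀ n, L n ∈ Icc 0 (2 * diam (univ : Set M)) := fun n => by
    refine ⟨(P n).L0, ?_⟩
    have h1 := (P n).Lc
    have h2 := hc n
    have h3 := hD.le p (x n)
    have h4 : dist p (x n) ≤ diam (univ : Set M) :=
      dist_le_diam_of_mem isCompact_univ.isBounded (mem_univ _) (mem_univ _)
    linarith
  obtain ⟨LL, hLL0, hLL⟩ := ultra_lim isCompact_Icc U L hLb
  have hs : ∀ n t, ∃ s ∈ A n, ∀ a ∈ A n, |s - t| ≤ |a - t| := fun n t =>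
    Set.exists_min_image (A n) (fun a => |a - t|) (P n).fin ⟨0, (P n).zero⟩
  choose s hsA hsmin using hs
  set AA : Set ℝ := {t | Tendsto (fun n => s n t) U (𝓝 t)} with hAA
  have hg : ∀ t, ∃ y ∈ (univ : Set M), Tendsto (fun n => γ n (s n t)) U (𝓝 y) := fun t =>
    ultra_lim isCompact_univ U _ (fun n => mem_univ _)
  choose g _ hg using hg
  -- Lipschitz in the limit
  have hDcont : ∀ (u v : ℕ → M) (a b : M), Tendsto u U (𝓝 a) → Tendsto v U (𝓝 b) →
      Tendsto (fun n => D (u n) (v n)) U (𝓝 (D a b)) := by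
    intro u v a b hu hv
    rw [tendsto_iff_dist_tendsto_zero] at hu hv ⊢
    have h := hu.add hv
    rw [add_zero] at h
    refine squeeze_zero (fun _ => dist_nonneg) (fun n => ?_) h
    rw [Real.dist_eq]
    have h1 := hD.abs_sub (u n) (v n) b
    have h2 := hD.abs_sub b (u n) a
    rw [hD.symm b, hD.symm b] at h2
    have h3 := abs_sub_le (D (u n) (v n)) (D (u n) b) (D a b)
    have h4 := hD.le (u n) a
    have h5 := hD.le (v n) b
    linarith
  have hglip : ∀ t ∈ AA, ∀ t' ∈ AA, D (g t) (g t') ≤ |t - t'| := by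
    intro t ht t' ht'
    exact le_of_tendsto_of_tendsto (hDcont _ _ _ _ (hg t) (hg t'))
      ((Tendsto.sub ht ht').abs)
      (Eventually.of_forall fun n => (P n).lip _ (hsA n t) _ (hsA n t'))
  have h0A : (0 : ℝ) ∈ AA := by
    have : ∀ n, s n 0 = 0 := fun n => by
      have := hsmin n 0 0 (P n).zero
      simpa using this
    simp only [hAA, mem_setOf_eq, this]
    exact tendsto_const_nhds
  have hLA : LL ∈ AA := by
    simp only [hAA, mem_setOf_eq]
    rw [tendsto_iff_dist_tendsto_zero] at hLL ⊢
    exact squeeze_zero (fun _ => dist_nonneg) (fun n => hsmin n LL _ (P n).last) hLL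
  have hg0 : g 0 = p := by
    have : ∀ n, s n 0 = 0 := fun n => by
      have := hsmin n 0 0 (P n).zero
      simpa using this
    have h2 := hg 0
    simp only [this, (P _).g0] at h2
    exact tendsto_nhds_unique h2 tendsto_const_nhds
  have hgL : D (g LL) xx = 0 := by
    have h1 := hDcont _ _ _ _ (hg LL) hxx
    have h2 : Tendsto (fun n => |s n LL - L n|) U (𝓝 |LL - LL|) :=
      (Tendsto.sub hLA hLL).abs
    rw [sub_self, abs_zero] at h2
    refine le_antisymm (le_of_tendsto_of_tendsto h1 h2 (Eventually.of_forall fun n => ?_))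
      (hD.nonneg _ _)
    have h3 := (P n).lip _ (hsA n LL) _ (P n).last
    rwa [(P n).gL] at h3
  -- complement
  have hout : ∀ t ∉ AA, ∃ ε > 0, ∀ᶠ n in (U : Filter ℕ), ∀ a ∈ A n, ε ≤ |a - t| := by
    intro t ht
    simp only [hAA, mem_setOf_eq, Metric.tendsto_nhds, not_forall] at ht
    obtain ⟨ε, hε, h⟩ := ht
    refine ⟨ε, hε, ?_⟩
    rw [← Ultrafilter.eventually_not] at h
    filter_upwards [h] with n hn a ha
    rw [Real.dist_eq] at hn
    exact (not_lt.1 hn).trans (hsmin n t a ha)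
  have hopen : IsOpen AAᶜ := by
    rw [Metric.isOpen_iff]
    intro t ht
    obtain ⟨ε, hε, h⟩ := hout t ht
    refine ⟨ε / 2, by positivity, fun t' ht' hA => ?_⟩
    have h1 := (Metric.tendsto_nhds.1 hA) (ε / 2) (by positivity)
    obtain ⟨n, hn, hn'⟩ := (h.and h1).exists
    have h2 := hn _ (hsA n t')
    rw [mem_ball, Real.dist_eq] at ht'
    rw [Real.dist_eq] at hn'
    have := abs_sub_le (s n t') t' t
    linarith
  set B : Set ℝ := AAᶜ ∩ Ioo 0 LL with hB
  have hBo : IsOpen B := hopen.inter isOpen_Ioo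
  have hcl : ∀ᶠ n in (U : Filter ℕ), c n ≤ D p xx - δ / 2 := by
    have : ∀ᶠ n in (U : Filter ℕ), D p (x n) < D p xx + δ / 2 :=
      hDx.eventually (gt_mem_nhds (by linarith))
    filter_upwards [this] with n hn
    linarith [hc n]
  have hpos : 0 ≤ D p xx - δ / 2 := by
    obtain ⟨n, hn⟩ := hcl.exists
    linarith [(P n).L0, (P n).Lc]
  have hBvol : volume B ≤ ENNReal.ofReal (D p xx - δ / 2) := by
    rw [hBo.measure_eq_iSup_isCompact]
    refine iSup₂_le fun K hKB => iSup_le fun hK => ?_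
    have : ∀ᶠ n in (U : Filter ℕ), K ⊆ G n := by
      refine hK.induction_on (p := fun S => ∀ᶠ n in (U : Filter ℕ), S ⊆ G n) ?_ ?_ ?_ ?_
      · simp
      · intro S T hST h
        filter_upwards [h] with n hn using hST.trans hn
      · intro S T h1 h2
        filter_upwards [h1, h2] with n hn1 hn2 using union_subset hn1 hn2
      · intro t ht
        obtain ⟨htA, ht0, htL⟩ := hKB ht
        obtain ⟨ε, hε, h⟩ := hout t htA
        obtain ⟨b, hb1, hb2⟩ := exists_between htL
        refine ⟨Ioo 0 b ∩ ball t (ε / 2), mem_nhdsWithin_of_mem_nhds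
          (inter_mem (Ioo_mem_nhds ht0 hb1) (ball_mem_nhds _ (by positivity))), ?_⟩
        filter_upwards [h, hLL.eventually (lt_mem_nhds hb2),
          hrU.eventually (gt_mem_nhds (half_pos hε))] with n hn hn2 hn3
        rintro t' ⟨⟨h1, h2⟩, h3⟩
        by_contra hG
        obtain ⟨a, ha, hat⟩ := (P n).cov t' ⟨h1.le, (h2.trans hn2).le⟩ hG
        have h4 := hn a ha
        rw [mem_ball, Real.dist_eq] at h3
        have := abs_sub_le a t' t
        linarith
    obtain ⟨n, h1, h2⟩ := (this.and hcl).exists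
    exact (measure_mono h1).trans ((P n).vol.trans (ENNReal.ofReal_le_ofReal h2))
  -- the real function
  have hglip' : LipschitzOnWith (Real.toNNReal η⁻¹) g AA := by
    refine LipschitzOnWith.of_dist_le_mul fun t ht t' ht' => ?_
    rw [Real.coe_toNNReal _ (inv_nonneg.2 hη.le), Real.dist_eq]
    have h1 := (hlow _ _).trans (hglip t ht t' ht')
    rw [inv_mul_eq_div, le_div_iff₀ hη]
    linarith
  have hnull := hM AA g _ hglip'
  have hfl : LipschitzWith 1 (fun y => D p y) := by
    refine LipschitzWith.of_dist_le_mul fun y z => ?_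
    rw [Real.dist_eq, NNReal.coe_one, one_mul]
    exact (hD.abs_sub p y z).trans (hD.le y z)
  have hnull2 : volume ((fun t => D p (g t)) '' AA) = 0 := by
    have h1 := hfl.hausdorffMeasure_image_le (d := 1) zero_le_one (g '' AA)
    rw [hnull, mul_zero, image_image, hausdorffMeasure_real] at h1
    exact le_antisymm h1 zero_le
  have hfg : LipschitzOnWith 1 (fun t => D p (g t)) AA := by
    refine LipschitzOnWith.of_dist_le_mul fun t ht t' ht' => ?_
    rw [Real.dist_eq, Real.dist_eq, NNReal.coe_one, one_mul]
    exact (hD.abs_sub p _ _).trans (hglip t ht t' ht')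
  obtain ⟨F, hF, hFe⟩ := hfg.extend_real
  have hF0 : F 0 = 0 := by rw [← hFe h0A]; simp [hg0, hD.self]
  have hFL : F LL = D p xx := by
    rw [← hFe hLA]
    have := hD.abs_sub p (g LL) xx
    rw [hgL] at this
    have := abs_nonpos_iff.1 this
    simp only
    linarith
  have hsub : Icc 0 (D p xx) ⊆ (fun t => D p (g t)) '' AA ∪ F '' B := by
    have h1 := intermediate_value_Icc hLL0.1 hF.continuous.continuousOn
    rw [hF0, hFL] at h1
    intro y hy
    obtain ⟨t, ht, rfl⟩ := h1 hy
    by_cases htA : t ∈ AA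
    · exact Or.inl ⟨t, htA, hFe htA⟩
    · refine Or.inr ⟨t, ⟨htA, lt_of_le_of_ne ht.1 ?_, lt_of_le_of_ne ht.2 ?_⟩, rfl⟩
      · rintro rfl; exact htA h0A
      · rintro rfl; exact htA hLA
  have hFB : volume (F '' B) ≤ volume B := by
    have h1 := hF.hausdorffMeasure_image_le (d := 1) zero_le_one B
    simpa [hausdorffMeasure_real] using h1
  have hfin : ENNReal.ofReal (D p xx) ≤ ENNReal.ofReal (D p xx - δ / 2) := by
    calc ENNReal.ofReal (D p xx) = volume (Icc 0 (D p xx)) := by simp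
      _ ≤ _ := measure_mono hsub
      _ ≤ _ := measure_union_le _ _
      _ ≤ _ := by rw [hnull2, zero_add]; exact hFB.trans hBvol
  rw [ENNReal.ofReal_le_ofReal_iff hpos] at hfin
  linarith

lemma step [CompactSpace M] [MeasurableSpace M] [BorelSpace M]
    (hM : Purely1Unrectifiable M) (p : M) {D : M → M → ℝ} (hD : Good D) (δ : ℝ) (hδ : 0 < δ) :
    ∃ D' : M → M → ℝ, Good D' ∧ (∀ x y, D' x y ≤ D x y) ∧
      (∃ r > 0, ∀ x y, D x y ≤ r → D' x y ≤ D x y / 2) ∧ ∀ x, D p x - δ ≤ D' p x := by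
  by_contra hcon
  have : ∀ n : ℕ, ∃ x c, Reach D (1 / ((n : ℝ) + 1)) p x c ∧ c ≤ D p x - δ := by
    intro n
    by_contra hh
    push Not at hh
    refine hcon ⟨nD D (1 / ((n : ℝ) + 1)), nD_good hD _, nD_le_self hD _,
      ⟨1 / ((n : ℝ) + 1), by positivity, fun x y hxy => ?_⟩, fun x => le_nD fun c hc =>
        (hh x c hc).le⟩
    refine (nD_le hD (reach_one _ _ _ _)).trans ?_
    unfold phi
    rw [if_pos hxy]
  choose x c hR hc using this
  have := fun n => (hR n).par hD (by positivity)
  choose L A G γ P using this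
  exact limit_step hM hD p δ hδ _ tendsto_one_div_add_atTop_nhds_zero_nat x c L A G γ P hc

end LFlat

open LFlat in
theorem exists_locallyFlat_almost_separating
    {M : Type*} [MetricSpace M] [CompactSpace M] [MeasurableSpace M] [BorelSpace M]
    (hM : Purely1Unrectifiable M) (p : M) (δ : ℝ) (hδ : 0 < δ) :
    ∃ g : M → ℝ, LipschitzWith 1 g ∧ LocallyFlat g ∧
      ∀ x : M, g x - g p ≥ dist p x - δ := by
  have hstep : ∀ (n : ℕ) (D : {D : M → M → ℝ // Good D}), ∃ D' : {D : M → M → ℝ // Good D},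
      (∀ x y, D'.1 x y ≤ D.1 x y) ∧
      (∃ r > 0, ∀ x y, D.1 x y ≤ r → D'.1 x y ≤ D.1 x y / 2) ∧
      ∀ x, D.1 p x - δ * (1 / 2) ^ (n + 1) ≤ D'.1 p x := by
    intro n D
    obtain ⟨D', h1, h2⟩ := LFlat.step hM p D.2 (δ * (1 / 2) ^ (n + 1)) (by positivity)
    exact ⟨⟨D', h1⟩, h2⟩
  choose S hS1 hS2 hS3 using hstep
  have hg0 : Good (fun x y : M => dist x y) :=
    ⟨dist_self, dist_comm, dist_triangle, fun _ _ => le_rfl, 1, one_pos, fun x y => by simp⟩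
  let E : ℕ → {D : M → M → ℝ // Good D} := fun n => Nat.rec ⟨_, hg0⟩ S n
  have hE : ∀ n, E (n + 1) = S n (E n) := fun n => rfl
  have hanti : ∀ x y, Antitone (fun n => (E n).1 x y) := fun x y =>
    antitone_nat_of_succ_le fun n => by rw [hE]; exact hS1 n (E n) x y
  have hlow : ∀ n x, dist p x - δ * (1 - (1 / 2) ^ n) ≤ (E n).1 p x := by
    intro n x
    induction n with
    | zero => simp [E]
    | succ n ih =>
      rw [hE]
      have := hS3 n (E n) x
      rw [pow_succ] at this ⊢
      linarith
  have hflat : ∀ n : ℕ, ∃ ρ > 0, ∀ x y : M, dist x y ≤ ρ →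
      (E n).1 x y ≤ (1 / 2) ^ n * dist x y := by
    intro n
    induction n with
    | zero => exact ⟨1, one_pos, fun x y _ => by simp [E]⟩
    | succ n ih =>
      obtain ⟨ρ, hρ, h⟩ := ih
      obtain ⟨r, hr, h'⟩ := hS2 n (E n)
      refine ⟨min ρ r, lt_min hρ hr, fun x y hxy => ?_⟩
      have h1 := h x y (hxy.trans (min_le_left _ _))
      have h2 := h' x y (((E n).2.le x y).trans (hxy.trans (min_le_right _ _)))
      rw [hE, pow_succ]
      linarith
  have hlim : ∀ x, Tendsto (fun n => (E n).1 p x) atTop (𝓝 (⨅ n, (E n).1 p x)) := fun x =>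
    tendsto_atTop_ciInf (hanti p x) ⟨0, by rintro _ ⟨n, rfl⟩; exact (E n).2.nonneg _ _⟩
  have hdiff : ∀ n x y, |(⨅ n, (E n).1 p x) - ⨅ n, (E n).1 p y| ≤ (E n).1 x y := by
    intro n x y
    refine le_of_tendsto ((hlim x).sub (hlim y)).abs ?_
    filter_upwards [eventually_ge_atTop n] with m hm
    exact ((E m).2.abs_sub p x y).trans (hanti x y hm)
  refine ⟨fun x => ⨅ n, (E n).1 p x, ?_, ?_, ?_⟩
  · refine LipschitzWith.of_dist_le_mul fun x y => ?_
    rw [Real.dist_eq, NNReal.coe_one, one_mul]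
    exact hdiff 0 x y
  · intro q ε hε
    obtain ⟨n, hn⟩ := exists_pow_lt_of_lt_one hε (by norm_num : (1 / 2 : ℝ) < 1)
    obtain ⟨ρ, hρ, h⟩ := hflat n
    refine ⟨ρ / 2, by positivity, fun x y hx hy => ?_⟩
    have hxy : dist x y ≤ ρ := by linarith [dist_triangle_right x y q]
    exact (hdiff n x y).trans ((h x y hxy).trans (by gcongr))
  · intro x
    have h1 : (⨅ n, (E n).1 p p) = 0 := by simp [(E _).2.self]
    have h2 : dist p x - δ ≤ ⨅ n, (E n).1 p x := by
      refine le_ciInf fun n => (?_ : _ ≤ _).trans (hlow n x)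
      have : 0 ≤ δ * (1 / 2) ^ n := by positivity
      linarith
    simp only [h1]
    linarith
end

section
/- Let (M,d) be a 1-bounded turning arc, let r > 0, δ ∈ (0,∞], and let T ⊆ M be a set whose Hausdorff pre-measure at scale δ computed with the pseudometric d_ur is less than r, i.e., there is a countable cover T ⊆ ⋃ᵢ Tᵢ with each d_ur-diameter sup_{x,y ∈ Tᵢ} d_ur(x,y) < δ and Σᵢ sup_{x,y ∈ Tᵢ} d_ur(x,y) < r. Then there exist subsets S, A ⊆ M such that T ⊆ S ∪ A, H¹_δ(A) < r (computed with the metric d), and S is H¹-σ-finite with respect to d. -/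
open Metric Set MeasureTheory
open scoped ENNReal NNReal

/-- The pseudometric `d_ur`: `d_ur(x,y)` is the infimum of `λ([min K, max K] ∖ K)` over all
nonempty compact `K ⊆ ℝ` and 1-Lipschitz maps `γ : K → M` with `γ(min K) = x` and
`γ(max K) = y`. -/
noncomputable def dur {M : Type*} [MetricSpace M] (x y : M) : ℝ :=
  sInf { c : ℝ | ∃ (K : Set ℝ) (γ : ℝ → M), K.Nonempty ∧ IsCompact K ∧
    LipschitzOnWith 1 γ K ∧ γ (sInf K) = x ∧ γ (sSup K) = y ∧
    c = (volume (Set.Icc (sInf K) (sSup K) \ K)).toReal }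

/-- The diameter of a set with respect to the pseudometric `d_ur`. -/
noncomputable def durDiam {M : Type*} [MetricSpace M] (E : Set M) : ℝ≥0∞ :=
  ⨆ (x) (_ : x ∈ E) (y) (_ : y ∈ E), ENNReal.ofReal (dur x y)

/-- The Hausdorff 1-pre-measure at scale `δ` (with respect to the metric `d`): the infimum
of `∑ diam (E i)` over countable covers by sets of diameter `< δ`. -/
noncomputable def hausdorffPre {Ω : Type*} [MetricSpace Ω] (δ : ℝ≥0∞) (S : Set Ω) : ℝ≥0∞ :=
  ⨅ (E : ℕ → Set Ω) (_ : S ⊆ ⋃ i, E i) (_ : ∀ i, EMetric.diam (E i) < δ),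
    ∑' i, EMetric.diam (E i)

/-- A set is `H¹`-σ-finite (with respect to the metric `d`) if it is a countable union of
sets of finite Hausdorff 1-measure. -/
def IsH1SigmaFinite {M : Type*} [MetricSpace M] [MeasurableSpace M] [BorelSpace M]
    (S : Set M) : Prop :=
  ∃ T : ℕ → Set M, S = ⋃ n, T n ∧ ∀ n, μH[1] (T n) < ⊤

lemma diam_arc {M : Type*} [MetricSpace M] (h : Set.Icc (0:ℝ) 1 ≃ₜ M)
    (hbt : ∀ s t u : Set.Icc (0:ℝ) 1, s ≤ t → t ≤ u →
      max (dist (h s) (h t)) (dist (h t) (h u)) ≤ dist (h s) (h u))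
    (x y : Set.Icc (0:ℝ) 1) : EMetric.diam (h '' Set.Icc x y) ≤ edist (h x) (h y) := by
  have key : ∀ s t : Set.Icc (0:ℝ) 1, x ≤ s → s ≤ t → t ≤ y →
      dist (h s) (h t) ≤ dist (h x) (h y) := fun s t h1 h2 h3 =>
    ((le_max_right _ _).trans (hbt x s t h1 h2)).trans
      ((le_max_left _ _).trans (hbt x t y (h1.trans h2) h3))
  apply EMetric.diam_le
  rintro _ ⟨s, hs, rfl⟩ _ ⟨t, ht, rfl⟩
  rw [edist_dist, edist_dist]
  apply ENNReal.ofReal_le_ofReal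
  rcases le_total s t with hst | hst
  · exact key s t hs.1 hst ht.2
  · rw [dist_comm]; exact key t s ht.1 hst hs.2

lemma dur_cov {M : Type*} [MetricSpace M] [MeasurableSpace M] [BorelSpace M]
    (h : Set.Icc (0:ℝ) 1 ≃ₜ M)
    (hbt : ∀ s t u : Set.Icc (0:ℝ) 1, s ≤ t → t ≤ u →
      max (dist (h s) (h t)) (dist (h t) (h u)) ≤ dist (h s) (h u))
    (x y : Set.Icc (0:ℝ) 1) (c : ℝ≥0∞) (hc : ENNReal.ofReal (dur (h x) (h y)) < c) :
    ∃ (S : Set M) (ι : Type) (_ : Countable ι) (A : ι → Set M), μH[1] S < ⊤ ∧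
      h '' Set.Icc x y ⊆ S ∪ ⋃ i, A i ∧ ∑' i, EMetric.diam (A i) < c := by
  have hne : { c : ℝ | ∃ (K : Set ℝ) (γ : ℝ → M), K.Nonempty ∧ IsCompact K ∧
    LipschitzOnWith 1 γ K ∧ γ (sInf K) = h x ∧ γ (sSup K) = h y ∧
    c = (volume (Set.Icc (sInf K) (sSup K) \ K)).toReal }.Nonempty := by
    rcases eq_or_ne (h x) (h y) with hxy | hxy
    · exact ⟨_, {0}, fun _ => h x, by simp, isCompact_singleton, by simp [LipschitzOnWith], rfl,
        hxy, rfl⟩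
    · have hd : 0 < dist (h x) (h y) := dist_pos.2 hxy
      have hK1 : sInf ({0, dist (h x) (h y)} : Set ℝ) = 0 := by
        rw [csInf_pair]; exact inf_of_le_left hd.le
      have hK2 : sSup ({0, dist (h x) (h y)} : Set ℝ) = dist (h x) (h y) := by
        rw [csSup_pair]; exact sup_of_le_right hd.le
      refine ⟨_, {0, dist (h x) (h y)}, fun t => if t = 0 then h x else h y, by simp,
        (Set.toFinite _).isCompact, ?_, ?_, ?_, rfl⟩
      · apply LipschitzOnWith.of_dist_le_mul
        rintro s (rfl | rfl) t (rfl | rfl) <;> simp [hd.ne', dist_comm, Real.dist_eq]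
      · simp [hK1]
      · rw [hK2]; simp [hxy]
  obtain ⟨c', hc'1, hc'2⟩ : ∃ c' : ℝ, dur (h x) (h y) < c' ∧ ENNReal.ofReal c' ≤ c := by
    obtain ⟨q, hq1, hq2⟩ := ENNReal.lt_iff_exists_nnreal_btwn.1 hc
    refine ⟨q, ?_, by simpa using hq2.le⟩
    have := (ENNReal.ofReal_lt_iff_lt_toReal (b := (q:ℝ≥0∞)) ?_ ENNReal.coe_ne_top).1 hq1
    · simpa using this
    · apply Real.sInf_nonneg
      rintro _ ⟨K, γ, -, -, -, -, -, rfl⟩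
      exact ENNReal.toReal_nonneg
  obtain ⟨_, ⟨K, γ, hKn, hK, hγ, h1, h2, rfl⟩, hlt⟩ := exists_lt_of_csInf_lt hne hc'1
  have hfin : volume (Set.Icc (sInf K) (sSup K) \ K) ≠ ⊤ :=
    ((measure_mono diff_subset).trans_lt (by simp : volume (Set.Icc (sInf K) (sSup K)) < ⊤)).ne
  let J : Set (ℝ × ℝ) := {p | p.1 ∈ K ∧ p.2 ∈ K ∧ p.1 < p.2 ∧ ∀ t ∈ K, ¬ (p.1 < t ∧ t < p.2)}
  have hdisj : J.PairwiseDisjoint (fun p => Set.Ioo p.1 p.2) := by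
    rintro ⟨a, b⟩ ⟨ha, hb, hab, hn⟩ ⟨a', b'⟩ ⟨ha', hb', hab', hn'⟩ hne
    rw [Function.onFun, Set.disjoint_left]
    rintro t ⟨ht1, ht2⟩ ⟨ht3, ht4⟩
    simp only at *
    have e1 := hn a' ha'
    have e2 := hn b' hb'
    have e3 := hn' a ha
    have e4 := hn' b hb
    apply hne
    ext
    · by_contra hh
      rcases lt_or_gt_of_ne hh with hh | hh
      · exact e1 ⟨hh, by linarith⟩
      · exact e3 ⟨hh, by linarith⟩
    · by_contra hh
      rcases lt_or_gt_of_ne hh with hh | hh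
      · exact e4 ⟨by linarith, hh⟩
      · exact e2 ⟨by linarith, hh⟩
  have hJc : J.Countable := by
    apply hdisj.countable_of_isOpen (fun _ _ => isOpen_Ioo)
    rintro p hp
    exact nonempty_Ioo.2 hp.2.2.1
  haveI : Countable J := hJc.to_subtype
  refine ⟨γ '' K, J, inferInstance,
    fun p => h '' Set.Icc (h.symm (γ p.1.1)) (h.symm (γ p.1.2)), ?_, ?_, ?_⟩
  · refine (hγ.hausdorffMeasure_image_le zero_le_one).trans_lt ?_
    rw [hausdorffMeasure_real]
    simpa using hK.measure_lt_top
  · rintro _ ⟨p, hp, rfl⟩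
    by_cases hpK : h p ∈ γ '' K
    · exact Or.inl hpK
    right
    have hcont : ContinuousOn (fun t => h.symm (γ t)) K :=
      h.symm.continuous.comp_continuousOn hγ.continuousOn
    have hneq : ∀ t ∈ K, h.symm (γ t) ≠ p := fun t ht e => hpK ⟨t, ht, by simp [← e]⟩
    have hL : IsCompact (K ∩ (fun t => h.symm (γ t)) ⁻¹' Set.Iic p) :=
      hK.of_isClosed_subset (hcont.preimage_isClosed_of_isClosed hK.isClosed isClosed_Iic)
        inter_subset_left
    have hLn : (K ∩ (fun t => h.symm (γ t)) ⁻¹' Set.Iic p).Nonempty :=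
      ⟨sInf K, hK.sInf_mem hKn, by simpa [h1] using hp.1⟩
    obtain ⟨a, ⟨haK, hap⟩, ha⟩ := hL.exists_isGreatest hLn
    have hR : IsCompact (K ∩ (fun t => h.symm (γ t)) ⁻¹' Set.Ici p ∩ Set.Ici a) :=
      (hK.of_isClosed_subset (hcont.preimage_isClosed_of_isClosed hK.isClosed isClosed_Ici)
        inter_subset_left).inter_right isClosed_Ici
    have hRn : (K ∩ (fun t => h.symm (γ t)) ⁻¹' Set.Ici p ∩ Set.Ici a).Nonempty :=
      ⟨sSup K, ⟨hK.sSup_mem hKn, by simpa [h2] using hp.2⟩, le_csSup hK.bddAbove haK⟩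
    obtain ⟨b, ⟨⟨hbK, hbp⟩, hab⟩, hb⟩ := hR.exists_isLeast hRn
    have hab' : a < b := by
      refine lt_of_le_of_ne hab ?_
      rintro rfl
      exact hneq a haK (le_antisymm hap hbp)
    refine mem_iUnion.2 ⟨⟨(a, b), haK, hbK, hab', ?_⟩, p, ⟨hap, hbp⟩, rfl⟩
    rintro t ht ⟨hat, htb⟩
    simp only at hat htb
    rcases le_total (h.symm (γ t)) p with hh | hh
    · exact absurd (ha ⟨ht, hh⟩) (not_le.2 hat)
    · exact absurd (hb ⟨⟨ht, hh⟩, hat.le⟩) (not_le.2 htb)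
  · calc _ ≤ ∑' p : J, volume (Set.Ioo p.1.1 p.1.2) := by
          refine ENNReal.tsum_le_tsum fun p => (diam_arc h hbt _ _).trans ?_
          simp only [Homeomorph.apply_symm_apply, Real.volume_Ioo]
          refine (hγ p.2.1 p.2.2.1).trans ?_
          rw [edist_comm, edist_dist, Real.dist_eq, abs_of_pos (sub_pos.2 p.2.2.2.1)]
          simp
      _ = volume (⋃ p ∈ J, Set.Ioo p.1 p.2) :=
          (measure_biUnion hJc hdisj (fun _ _ => measurableSet_Ioo)).symm
      _ ≤ volume (Set.Icc (sInf K) (sSup K) \ K) := by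
          apply measure_mono
          refine iUnion₂_subset fun p hp t ht => ⟨⟨?_, ?_⟩, fun htK => hp.2.2.2 t htK ht⟩
          · exact (csInf_le hK.bddBelow hp.1).trans ht.1.le
          · exact ht.2.le.trans (le_csSup hK.bddAbove hp.2.1)
      _ = ENNReal.ofReal (volume (Set.Icc (sInf K) (sSup K) \ K)).toReal :=
          (ENNReal.ofReal_toReal hfin).symm
      _ < ENNReal.ofReal c' :=
          (ENNReal.ofReal_lt_ofReal_iff (ENNReal.toReal_nonneg.trans_lt hlt)).2 hlt
      _ ≤ c := hc'2

lemma set_cov {M : Type*} [MetricSpace M] [MeasurableSpace M] [BorelSpace M]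
    (h : Set.Icc (0:ℝ) 1 ≃ₜ M)
    (hbt : ∀ s t u : Set.Icc (0:ℝ) 1, s ≤ t → t ≤ u →
      max (dist (h s) (h t)) (dist (h t) (h u)) ≤ dist (h s) (h u))
    (E : Set M) (c : ℝ≥0∞) (hc : durDiam E < c) :
    ∃ (S : Set M) (ι : Type) (_ : Countable ι) (A : ι → Set M), μH[1] S < ⊤ ∧
      E ⊆ S ∪ ⋃ i, A i ∧ ∑' i, EMetric.diam (A i) < c := by
  rcases E.eq_empty_or_nonempty with rfl | hE
  · exact ⟨∅, Empty, inferInstance, fun _ => ∅, by simp, by simp, by simpa using bot_le.trans_lt hc⟩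
  obtain ⟨c₁, hc1, hc2⟩ := exists_between hc
  obtain ⟨ε, hε, hεc⟩ : ∃ ε : ℝ≥0∞, 0 < ε ∧ ε + (ε + c₁) ≤ c := by
    have hc1t : c₁ ≠ ⊤ := hc2.ne_top
    refine ⟨(c - c₁) / 2, ENNReal.div_pos (tsub_pos_of_lt hc2).ne' (by simp), ?_⟩
    rw [← add_assoc, ENNReal.add_halves, tsub_add_cancel_of_le hc2.le]
  have hn : (closure (h ⁻¹' E)).Nonempty := (hE.preimage h.surjective).closure
  obtain ⟨a, ha, ha'⟩ := (isClosed_closure (s := h ⁻¹' E)).isCompact.exists_isLeast hn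
  obtain ⟨b, hb, hb'⟩ := (isClosed_closure (s := h ⁻¹' E)).isCompact.exists_isGreatest hn
  have happ : ∀ a ∈ closure (h ⁻¹' E), ∃ x, h x ∈ E ∧ edist (h a) (h x) < ε := by
    intro a ha
    have : h a ∈ closure E := h.continuous.closure_preimage_subset E ha
    obtain ⟨z, hz, hz'⟩ := EMetric.mem_closure_iff.1 this ε hε
    exact ⟨h.symm z, by simpa using hz, by simpa using hz'⟩
  obtain ⟨x, hx, hax⟩ := happ a ha
  obtain ⟨y, hy, hby⟩ := happ b hb
  obtain ⟨S, ι, _, A, hS, hcov, hsum⟩ := dur_cov h hbt x y c₁ (lt_of_le_of_lt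
    (le_iSup₂_of_le (f := fun x (_ : x ∈ E) => ⨆ (y) (_ : y ∈ E), ENNReal.ofReal (dur x y))
      (h x) hx (le_iSup₂_of_le (f := fun y (_ : y ∈ E) => ENNReal.ofReal (dur (h x) y))
        (h y) hy le_rfl)) hc1)
  let B : Unit ⊕ Unit ⊕ ι → Set M := Sum.elim (fun _ => h '' Set.Icc a x)
    (Sum.elim (fun _ => h '' Set.Icc y b) A)
  refine ⟨S, Unit ⊕ Unit ⊕ ι, inferInstance, B, hS, ?_, ?_⟩
  · intro z hz
    have hzm : h.symm z ∈ closure (h ⁻¹' E) := subset_closure (by simpa using hz)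
    have hza := ha' hzm
    have hzb := hb' hzm
    rcases le_total (h.symm z) x with h1 | h1
    · exact Or.inr (mem_iUnion.2 ⟨.inl (), h.symm z, ⟨hza, h1⟩, by simp⟩)
    rcases le_total y (h.symm z) with h2 | h2
    · exact Or.inr (mem_iUnion.2 ⟨.inr (.inl ()), h.symm z, ⟨h2, hzb⟩, by simp⟩)
    rcases hcov ⟨h.symm z, ⟨h1, h2⟩, h.apply_symm_apply z⟩ with h3 | h3
    · exact Or.inl h3
    · obtain ⟨i, hi⟩ := mem_iUnion.1 h3
      exact Or.inr (mem_iUnion.2 ⟨.inr (.inr i), hi⟩)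
  · rw [Summable.tsum_sum ENNReal.summable ENNReal.summable,
      Summable.tsum_sum ENNReal.summable ENNReal.summable, tsum_fintype, tsum_fintype]
    simp only [Finset.univ_unique, Finset.sum_singleton]
    refine lt_of_lt_of_le ?_ hεc
    refine ENNReal.add_lt_add ((diam_arc h hbt a x).trans_lt hax) (ENNReal.add_lt_add ?_ hsum)
    exact (diam_arc h hbt y b).trans_lt (by rwa [edist_comm])

/-- If `(M,d)` is a 1-bounded turning arc, `r > 0`, `δ ∈ (0,∞]`, and `T ⊆ M` has Hausdorff
pre-measure at scale `δ` less than `r` with respect to the pseudometric `d_ur` — i.e. `T`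
has a countable cover by sets of `d_ur`-diameter `< δ` whose `d_ur`-diameters sum to less
than `r` — then there are `S, A ⊆ M` with `T ⊆ S ∪ A`, `H¹_δ(A) < r` (with respect to
`d`), and `S` is `H¹`-σ-finite with respect to `d`. -/
theorem inverse_preHausdorff_bounded_turning_arc
    {M : Type*} [MetricSpace M] [MeasurableSpace M] [BorelSpace M]
    (h : Set.Icc (0:ℝ) 1 ≃ₜ M)
    (hbt : ∀ s t u : Set.Icc (0:ℝ) 1, s ≤ t → t ≤ u →
      max (dist (h s) (h t)) (dist (h t) (h u)) ≤ dist (h s) (h u))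
    (r : ℝ) (hr : 0 < r) (δ : ℝ≥0∞) (hδ : 0 < δ) (T : Set M)
    (hcov : ∃ E : ℕ → Set M, T ⊆ ⋃ i, E i ∧ (∀ i, durDiam (E i) < δ) ∧
      ∑' i, durDiam (E i) < ENNReal.ofReal r) :
    ∃ S A : Set M, T ⊆ S ∪ A ∧ hausdorffPre δ A < ENNReal.ofReal r ∧
      IsH1SigmaFinite S := by
  obtain ⟨E, hTE, hEδ, hEs⟩ := hcov
  obtain ⟨c, hc1, hcδ, hcr⟩ : ∃ c : ℕ → ℝ≥0∞, (∀ i, durDiam (E i) < c i) ∧ (∀ i, c i ≤ δ) ∧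
      ∑' i, c i < ENNReal.ofReal r := by
    obtain ⟨ε, hε, hεs⟩ := ENNReal.exists_pos_sum_of_countable (tsub_pos_of_lt hEs).ne' ℕ
    refine ⟨fun i => min δ (durDiam (E i) + ε i), fun i => lt_min (hEδ i) ?_,
      fun i => min_le_left _ _, ?_⟩
    · exact ENNReal.lt_add_right (hEδ i).ne_top (by simpa using (hε i).ne')
    · calc _ ≤ ∑' i, (durDiam (E i) + ε i) := ENNReal.tsum_le_tsum fun i => min_le_right _ _
        _ = ∑' i, durDiam (E i) + ∑' i, (ε i : ℝ≥0∞) := ENNReal.tsum_add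
        _ < ∑' i, durDiam (E i) + (ENNReal.ofReal r - ∑' i, durDiam (E i)) :=
            ENNReal.add_lt_add_left hEs.ne_top hεs
        _ = ENNReal.ofReal r := add_tsub_cancel_of_le hEs.le
  choose S ι hι A hS hcov hsum using fun i => set_cov h hbt (E i) (c i) (hc1 i)
  let B : (Σ i, ι i) → Set M := fun p => A p.1 p.2
  refine ⟨⋃ i, S i, ⋃ p, B p, ?_, ?_, S, rfl, hS⟩
  · intro z hz
    obtain ⟨i, hi⟩ := mem_iUnion.1 (hTE hz)
    rcases hcov i hi with h1 | h1
    · exact Or.inl (mem_iUnion.2 ⟨i, h1⟩)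
    · obtain ⟨j, hj⟩ := mem_iUnion.1 h1
      exact Or.inr (mem_iUnion.2 ⟨⟨i, j⟩, hj⟩)
  · haveI : Encodable (Σ i, ι i) := Encodable.ofCountable _
    refine lt_of_le_of_lt (iInf_le_of_le
      (fun n => ⋃ b ∈ Encodable.decode₂ (Σ i, ι i) n, B b) (iInf₂_le_of_le ?_ ?_ le_rfl)) ?_
    · rw [Encodable.iUnion_decode₂]
    · intro n
      refine Encodable.iUnion_decode₂_cases (C := fun s => EMetric.diam s < δ) ?_ ?_
      · exact (Metric.ediam_empty (X := M)).trans_lt hδ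
      · rintro ⟨i, j⟩
        exact ((ENNReal.le_tsum j).trans_lt (hsum i)).trans_le (hcδ i)
    · rw [tsum_iUnion_decode₂ (fun s => EMetric.diam s) Metric.ediam_empty,
        ENNReal.tsum_sigma (fun i j => EMetric.diam (A i j))]
      exact (ENNReal.tsum_le_tsum fun i => (hsum i).le).trans_lt hcr
end

section
/- Let (M,d) be a 1-bounded turning arc with parametrizing homeomorphism h : [0,1] → M, and let x = h(0), y = h(1) be its endpoints. Then sup{|f(y) − f(x)| : f : M → ℝ is 1-Lipschitz and locally flat} = inf{H¹_∞(A) : A ⊆ M and M ∖ A is H¹-σ-finite}. -/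
open Metric Set MeasureTheory
open scoped ENNReal NNReal

/-- The Hausdorff 1-content of a set: infimum of `∑ diam (E i)` over countable covers. -/
noncomputable def hausdorffContent {Ω : Type*} [MetricSpace Ω] (S : Set Ω) : ℝ≥0∞ :=
  ⨅ (E : ℕ → Set Ω) (_ : S ⊆ ⋃ i, E i), ∑' i, EMetric.diam (E i)

open Filter Topology TopologicalSpace

namespace BTArc

section sf
variable {M : Type*} [MetricSpace M] [MeasurableSpace M] [BorelSpace M]

lemma sf_of_subset {S : Set M} (T : ℕ → Set M) (hS : S ⊆ ⋃ n, T n) (hT : ∀ n, μH[1] (T n) < ⊤) :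
    IsH1SigmaFinite S := by
  refine ⟨fun n => S ∩ T n, ?_, fun n => (measure_mono inter_subset_right).trans_lt (hT n)⟩
  rw [← inter_iUnion]
  exact (inter_eq_left.2 hS).symm

lemma sf_mono {S T : Set M} (hT : IsH1SigmaFinite T) (h : S ⊆ T) : IsH1SigmaFinite S := by
  obtain ⟨U, hU, hf⟩ := hT
  exact sf_of_subset U (hU ▸ h) hf

lemma sf_iUnion {S : ℕ → Set M} (hS : ∀ n, IsH1SigmaFinite (S n)) :
    IsH1SigmaFinite (⋃ n, S n) := by
  choose U hU hf using hS
  refine sf_of_subset (fun n => U n.unpair.1 n.unpair.2) ?_ (fun n => hf _ _)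
  intro p hp
  obtain ⟨n, hn⟩ := mem_iUnion.1 hp
  rw [hU n] at hn
  obtain ⟨m, hm⟩ := mem_iUnion.1 hn
  refine mem_iUnion.2 ⟨Nat.pair n m, ?_⟩
  simpa using hm

lemma sf_of_finite {S : Set M} (hS : μH[1] S < ⊤) : IsH1SigmaFinite S :=
  sf_of_subset (fun _ => S) (subset_iUnion (fun _ : ℕ => S) 0) (fun _ => hS)

lemma sf_union {S T : Set M} (hS : IsH1SigmaFinite S) (hT : IsH1SigmaFinite T) :
    IsH1SigmaFinite (S ∪ T) := by
  refine sf_mono (sf_iUnion (S := fun n : ℕ => if n = 0 then S else T) ?_) ?_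
  · intro n
    split_ifs <;> assumption
  · rintro p (hp | hp)
    · exact mem_iUnion.2 ⟨0, by simpa using hp⟩
    · exact mem_iUnion.2 ⟨1, by simpa using hp⟩

lemma sf_countable {S : Set M} (hS : S.Countable) : IsH1SigmaFinite S := by
  apply sf_of_finite
  have := Measure.nullSingletonClass_hausdorff M (d := 1) one_pos
  rw [hS.measure_zero]
  exact ENNReal.zero_lt_top

/-- images of finite sets under locally flat maps are null -/
lemma image_null [CompactSpace M] [Nonempty M] {f : M → ℝ} (hf : LocallyFlat f) {T : Set M}
    (hT : μH[1] T < ⊤) : volume (f '' T) = 0 := by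
  have key : ∀ ε : ℝ≥0, 0 < ε → volume (f '' T) ≤ ε * μH[1] T := by
    intro ε hε
    choose δ hδ hfl using fun p => hf p ε (by exact_mod_cast hε)
    obtain ⟨s, hs, hsu⟩ := _root_.countable_cover_nhds (fun p => ball_mem_nhds p (hδ p))
    have hsne : s.Nonempty := by
      by_contra hne
      rw [not_nonempty_iff_eq_empty] at hne
      subst hne
      obtain ⟨p⟩ := ‹Nonempty M›
      have : p ∈ (univ : Set M) := mem_univ p
      rw [← hsu] at this
      simp at this
    obtain ⟨e, rfl⟩ := hs.exists_eq_range hsne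
    let B : ℕ → Set M := fun n => ball (e n) (δ (e n))
    have hBm : ∀ n, MeasurableSet (disjointed B n) :=
      fun n => MeasurableSet.disjointed (fun n => isOpen_ball.measurableSet) n
    have hcov : (⋃ n, disjointed B n) = univ := by
      rw [iUnion_disjointed, ← hsu, biUnion_range]
    have h1 : f '' T = ⋃ n, f '' (disjointed B n ∩ T) := by
      rw [← image_iUnion, ← iUnion_inter, hcov, univ_inter]
    have h2 : ∀ n, volume (f '' (disjointed B n ∩ T)) ≤ ε * (μH[1].restrict T) (disjointed B n) := by
      intro n
      rw [Measure.restrict_apply (hBm n), ← hausdorffMeasure_real]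
      have hl : LipschitzOnWith ε f (disjointed B n ∩ T) := by
        refine LipschitzOnWith.of_dist_le_mul fun x hx y hy => ?_
        rw [Real.dist_eq]
        exact hfl (e n) x y (disjointed_subset B n hx.1) (disjointed_subset B n hy.1)
      simpa using hl.hausdorffMeasure_image_le (d := 1) zero_le_one
    calc volume (f '' T) ≤ ∑' n, volume (f '' (disjointed B n ∩ T)) := by
          rw [h1]; exact measure_iUnion_le _
      _ ≤ ∑' n, ε * (μH[1].restrict T) (disjointed B n) := ENNReal.tsum_le_tsum h2
      _ = ε * (μH[1].restrict T) (⋃ n, disjointed B n) := by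
          rw [ENNReal.tsum_mul_left, measure_iUnion (disjoint_disjointed B) hBm]
      _ = ε * μH[1] T := by rw [hcov]; simp
  by_contra hne
  have hpos : 0 < volume (f '' T) := pos_iff_ne_zero.2 hne
  obtain ⟨c, hc0, hc⟩ := ENNReal.exists_nnreal_pos_mul_lt hT.ne hne
  exact absurd (key c hc0) (not_le.2 hc)

lemma upper [CompactSpace M] [ConnectedSpace M] {f : M → ℝ} (hL : LipschitzWith 1 f)
    (hf : LocallyFlat f) {A : Set M} (hA : IsH1SigmaFinite Aᶜ) (x y : M) :
    ENNReal.ofReal |f y - f x| ≤ hausdorffContent A := by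
  refine le_iInf₂ fun E hE => ?_
  obtain ⟨T, hT, hTf⟩ := hA
  have h0 : volume (f '' Aᶜ) = 0 := by
    rw [hT, image_iUnion]
    exact measure_iUnion_null fun n => image_null hf (hTf n)
  have h1 : volume (f '' A) ≤ ∑' i, EMetric.diam (E i) := by
    calc volume (f '' A) ≤ volume (⋃ i, f '' (E i)) := by
          apply measure_mono; rw [← image_iUnion]; exact image_mono hE
      _ ≤ ∑' i, volume (f '' (E i)) := measure_iUnion_le _
      _ ≤ _ := ENNReal.tsum_le_tsum fun i => by
          refine (Real.volume_le_diam _).trans ?_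
          have := hL.ediam_image_le (E i)
          rw [ENNReal.coe_one, one_mul] at this
          exact this
  have h2 : uIcc (f x) (f y) ⊆ f '' univ :=
    (isPreconnected_univ.image f hL.continuous.continuousOn).ordConnected.uIcc_subset
      (mem_image_of_mem _ (mem_univ _)) (mem_image_of_mem _ (mem_univ _))
  calc ENNReal.ofReal |f y - f x| = volume (uIcc (f x) (f y)) := by rw [Real.volume_interval]
    _ ≤ volume (f '' univ) := measure_mono h2
    _ = volume (f '' A ∪ f '' Aᶜ) := by rw [← image_union, union_compl_self]
    _ ≤ volume (f '' A) + volume (f '' Aᶜ) := measure_union_le _ _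
    _ ≤ _ := by rw [h0, add_zero]; exact h1

end sf

lemma exists_rank (D : ℕ → ℝ) (C : ℝ) (hD : ∀ i, 0 ≤ D i) (hC : ∀ s : Finset ℕ, ∑ i ∈ s, D i ≤ C) :
    ∃ r : ℕ → ℕ, InjOn r {i | 0 < D i} ∧ ∀ i, 0 < D i → ((r i : ℝ) + 1) * D i ≤ C := by
  let Q : ℕ → Set ℕ := fun i => {j | D i < D j ∨ (D i = D j ∧ j < i)}
  have hcard : ∀ i, ∀ s : Finset ℕ, (s : Set ℕ) ⊆ Q i → ((s.card : ℝ) + 1) * D i ≤ C := by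
    intro i s hs
    have hi : i ∉ s := by
      intro h
      have := hs h
      simp [Q] at this
    refine le_trans ?_ (hC (insert i s))
    rw [Finset.sum_insert hi]
    have : ∑ j ∈ s, D i ≤ ∑ j ∈ s, D j := by
      refine Finset.sum_le_sum fun j hj => ?_
      rcases hs hj with h | h
      · exact h.le
      · exact h.1.le
    rw [Finset.sum_const, nsmul_eq_mul] at this
    linarith
  have hfin : ∀ i, 0 < D i → (Q i).Finite := by
    intro i hi
    by_contra hinf
    obtain ⟨n, hn⟩ := exists_nat_gt (C / D i)
    obtain ⟨s, hs, hsc⟩ := Set.Infinite.exists_subset_card_eq hinf n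
    have := hcard i s hs
    rw [hsc] at this
    rw [div_lt_iff₀ hi] at hn
    nlinarith
  have hlt : ∀ i j, 0 < D i → i ∈ Q j → 0 < D j → (Q i).ncard < (Q j).ncard := by
    intro i j hi hij hj
    refine Set.ncard_lt_ncard ⟨?_, ?_⟩ (hfin j hj)
    · intro k hk
      simp only [Q, mem_ofPred_eq] at *
      grind
    · intro h
      have := h hij
      simp [Q] at this
  refine ⟨fun i => (Q i).ncard, ?_, ?_⟩
  · intro i hi j hj hij
    by_contra hne
    have : i ∈ Q j ∨ j ∈ Q i := by
      simp only [Q, mem_ofPred_eq]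
      grind
    rcases this with h | h
    · exact absurd hij (hlt i j hi h hj).ne
    · exact absurd hij (hlt j i hj h hi).ne'
  · intro i hi
    have := hcard i (hfin i hi).toFinset (by simp)
    rwa [← Set.ncard_eq_toFinset_card _ (hfin i hi)] at this

section main
variable {M : Type*} [MetricSpace M]

lemma normalize [CompactSpace M] [Nonempty M] (φ : ℝ → ℝ) (c : ℝ) (hc : 0 < c)
    (h0 : φ 0 = 0) (hφ : ∀ r, 0 ≤ r → c * r ≤ φ r) (E : ℕ → Set M) (a : ℝ≥0∞) (ha : a ≠ ⊤)
    (hE : ∑' i, ENNReal.ofReal (φ (diam (E i))) ≤ a) :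
    ∃ K : ℕ → NonemptyCompacts M,
      ∑' i, ENNReal.ofReal (φ (diam (K i : Set M))) ≤ a ∧
      (∀ j : ℕ, ((j : ℝ) + 1) * diam (K j : Set M) ≤ a.toReal / c) ∧
      ((⋃ i, E i) \ ⋃ j, (K j : Set M)).Countable := by
  classical
  obtain ⟨p0⟩ := ‹Nonempty M›
  have hsum : ∀ s : Finset ℕ, ∑ i ∈ s, diam (E i) ≤ a.toReal / c := by
    intro s
    rw [le_div_iff₀ hc, Finset.sum_mul]
    have h1 : ∑ i ∈ s, ENNReal.ofReal (φ (diam (E i))) ≤ a := (ENNReal.sum_le_tsum s).trans hE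
    rw [← ENNReal.ofReal_sum_of_nonneg] at h1
    · refine le_trans (Finset.sum_le_sum fun i _ => ?_) ((ENNReal.ofReal_le_iff_le_toReal ha).1 h1)
      rw [mul_comm]
      exact hφ _ diam_nonneg
    · intro i _
      exact le_trans (mul_nonneg hc.le diam_nonneg) (hφ _ diam_nonneg)
  obtain ⟨r, hr, hrC⟩ := exists_rank (fun i => diam (E i)) (a.toReal / c) (fun i => diam_nonneg) hsum
  have hne : ∀ i, 0 < diam (E i) → (E i).Nonempty := by
    intro i hi
    by_contra h
    rw [not_nonempty_iff_eq_empty] at h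
    rw [h] at hi
    simp at hi
  let P : ℕ → Prop := fun j => ∃ i, 0 < diam (E i) ∧ r i = j
  let K : ℕ → NonemptyCompacts M := fun j =>
    if h : P j then ⟨⟨closure (E h.choose), isClosed_closure.isCompact⟩,
      (hne _ h.choose_spec.1).closure⟩ else {p0}
  have hKP : ∀ j (h : P j), (K j : Set M) = closure (E h.choose) := by
    intro j h
    simp only [K, dif_pos h]
    rfl
  have hKN : ∀ j, ¬ P j → diam (K j : Set M) = 0 := by
    intro j h
    simp only [K, dif_neg h]
    simp
  refine ⟨K, ?_, ?_, ?_⟩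
  · refine le_trans ?_ hE
    have hsupp : Function.support (fun j => ENNReal.ofReal (φ (diam (K j : Set M)))) ⊆ {j | P j} := by
      intro j hj
      by_contra hP
      apply hj
      simp only
      rw [hKN j hP, h0, ENNReal.ofReal_zero]
    rw [← tsum_subtype_eq_of_support_subset hsupp]
    have hinj : Function.Injective (fun j : {j | P j} => (j.2 : P j).choose) := by
      intro j k hjk
      apply Subtype.ext
      rw [← (j.2 : P j).choose_spec.2, ← (k.2 : P k).choose_spec.2]
      exact congrArg r hjk
    refine le_trans (le_of_eq ?_) (ENNReal.tsum_comp_le_tsum_of_injective hinj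
      (fun i => ENNReal.ofReal (φ (diam (E i)))))
    refine tsum_congr fun j => ?_
    rw [hKP j j.2, diam_closure]
  · intro j
    by_cases h : P j
    · rw [hKP j h, diam_closure]
      have := hrC _ h.choose_spec.1
      rwa [h.choose_spec.2] at this
    · rw [hKN j h, mul_zero]
      positivity
  · have : ((⋃ i, E i) \ ⋃ j, (K j : Set M)) ⊆ ⋃ i ∈ {i | diam (E i) = 0}, E i := by
      rintro p ⟨hp, hpK⟩
      obtain ⟨i, hi⟩ := mem_iUnion.1 hp
      by_cases hd : diam (E i) = 0
      · exact mem_biUnion (show i ∈ {i | diam (E i) = 0} from hd) hi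
      · exfalso
        have hpos : 0 < diam (E i) := lt_of_le_of_ne diam_nonneg (Ne.symm hd)
        have hP : P (r i) := ⟨i, hpos, rfl⟩
        apply hpK
        refine mem_iUnion.2 ⟨r i, ?_⟩
        rw [hKP _ hP, hr hP.choose_spec.1 hpos hP.choose_spec.2]
        exact subset_closure hi
    refine Set.Countable.mono this (Set.Countable.biUnion (to_countable _) fun i hi => ?_)
    apply Set.Subsingleton.countable
    intro u hu v hv
    have := dist_le_diam_of_mem (isBounded_of_compactSpace (s := E i)) hu hv
    rw [show diam (E i) = 0 from hi] at this
    exact dist_le_zero.1 this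

end main
end BTArc

namespace BTArc

/-- content-type functional: cover `S` up to a sigma-finite set, with gauge `g` -/
noncomputable def W {M : Type*} [MetricSpace M] [MeasurableSpace M] [BorelSpace M]
    (g : ℝ → ℝ) (S : Set M) : ℝ≥0∞ :=
  ⨅ (E : ℕ → Set M) (_ : IsH1SigmaFinite (S \ ⋃ i, E i)), ∑' i, ENNReal.ofReal (g (diam (E i)))

/-- admissible gauges -/
structure Adm (g : ℝ → ℝ) : Prop where
  cont : Continuous g
  zero : g 0 = 0
  low : ∃ c : ℝ, 0 < c ∧ ∀ r, 0 ≤ r → c * r ≤ g r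

/-- halve the gauge at small scales -/
noncomputable def sh (g : ℝ → ℝ) (δ : ℝ) (r : ℝ) : ℝ := g r * max (1/2) (min 1 (r / δ))

lemma Adm.nonneg {g : ℝ → ℝ} (hg : Adm g) {r : ℝ} (hr : 0 ≤ r) : 0 ≤ g r := by
  obtain ⟨c, hc, h⟩ := hg.low
  exact (mul_nonneg hc.le hr).trans (h r hr)

lemma sh_le {g : ℝ → ℝ} (hg : Adm g) (δ : ℝ) {r : ℝ} (hr : 0 ≤ r) : sh g δ r ≤ g r := by
  have h1 : max (1/2) (min 1 (r / δ)) ≤ 1 := max_le (by norm_num) (min_le_left _ _)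
  have := mul_le_mul_of_nonneg_left h1 (hg.nonneg hr)
  rwa [mul_one] at this

lemma le_sh {g : ℝ → ℝ} (hg : Adm g) (δ : ℝ) {r : ℝ} (hr : 0 ≤ r) : g r / 2 ≤ sh g δ r := by
  have h1 : 1/2 ≤ max (1/2) (min 1 (r / δ)) := le_max_left _ _
  have := mul_le_mul_of_nonneg_left h1 (hg.nonneg hr)
  simp only [sh]
  linarith

lemma sh_eq {g : ℝ → ℝ} {δ : ℝ} (hδ : 0 < δ) {r : ℝ} (hr : δ ≤ r) : sh g δ r = g r := by
  have : 1 ≤ r / δ := by rwa [le_div_iff₀ hδ, one_mul]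
  rw [sh, min_eq_left this, max_eq_right (by norm_num), mul_one]

lemma sh_small {g : ℝ → ℝ} {δ : ℝ} (hδ : 0 < δ) {r : ℝ} (hr : r ≤ δ / 2) : sh g δ r = g r / 2 := by
  have : r / δ ≤ 1/2 := by rw [div_le_iff₀ hδ]; linarith
  rw [sh, max_eq_left ((min_le_right _ _).trans this)]
  ring

lemma Adm.sh {g : ℝ → ℝ} (hg : Adm g) (δ : ℝ) : Adm (sh g δ) := by
  obtain ⟨c, hc, h⟩ := hg.low
  refine ⟨?_, by simp [BTArc.sh, hg.zero], c / 2, by positivity, fun r hr => ?_⟩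
  · have := hg.cont
    unfold BTArc.sh
    fun_prop
  · have := le_sh hg δ hr
    have := h r hr
    linarith

section main
variable {M : Type*} [MetricSpace M]

lemma hd_subset {K L : NonemptyCompacts M} {η : ℝ} (h : dist K L < η) :
    (K : Set M) ⊆ thickening η (L : Set M) := by
  intro p hp
  rw [NonemptyCompacts.dist_eq] at h
  rw [mem_thickening_iff]
  exact exists_dist_lt_of_hausdorffDist_lt hp h
    (hausdorffEDist_ne_top_of_nonempty_of_bounded K.nonempty L.nonempty
      K.isCompact.isBounded L.isCompact.isBounded)

lemma diam_le_of_hd {K L : NonemptyCompacts M} {η : ℝ} (h : dist K L < η) :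
    diam (K : Set M) ≤ diam (L : Set M) + 2 * η :=
  (diam_mono (hd_subset h) L.isCompact.isBounded.thickening).trans
    (diam_thickening_le _ (dist_nonneg.trans h.le))

lemma continuous_diam : Continuous (fun K : NonemptyCompacts M => diam (K : Set M)) := by
  rw [Metric.continuous_iff]
  intro L ε hε
  refine ⟨ε / 4, by positivity, fun K hK => ?_⟩
  have h1 := diam_le_of_hd hK
  have h2 := diam_le_of_hd (by rwa [dist_comm] at hK)
  rw [Real.dist_eq, abs_lt]
  constructor <;> linarith

variable [MeasurableSpace M] [BorelSpace M]

lemma step [CompactSpace M] [Nonempty M] {g : ℝ → ℝ} (hg : Adm g) {a : ℝ≥0∞}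
    (ha : a < W g (univ : Set M)) : ∃ δ : ℝ, 0 < δ ∧ a < W (sh g δ) (univ : Set M) := by
  by_contra hcon
  push Not at hcon
  obtain ⟨b, hab, hb⟩ := exists_between ha
  have hbt : b ≠ ⊤ := (hb.trans_le le_top).ne
  obtain ⟨c, hc, hgc⟩ := hg.low
  let δ : ℕ → ℝ := fun k => 1 / ((k : ℝ) + 1)
  have hδ : ∀ k, 0 < δ k := fun k => by positivity
  have hδ0 : Tendsto δ atTop (𝓝 0) := tendsto_one_div_add_atTop_nhds_zero_nat
  -- choose covers
  have hcov : ∀ k, ∃ K : ℕ → NonemptyCompacts M,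
      ∑' i, ENNReal.ofReal (sh g (δ k) (diam (K i : Set M))) ≤ b ∧
      (∀ j : ℕ, ((j : ℝ) + 1) * diam (K j : Set M) ≤ b.toReal / (c / 2)) ∧
      IsH1SigmaFinite (⋃ j, (K j : Set M))ᶜ := by
    intro k
    have h1 : W (sh g (δ k)) (univ : Set M) < b := (hcon _ (hδ k)).trans_lt hab
    unfold W at h1
    simp only [iInf_lt_iff] at h1
    obtain ⟨E, hE, hEb⟩ := h1
    obtain ⟨K, hK1, hK2, hK3⟩ := normalize (sh g (δ k)) (c / 2) (by positivity) (hg.sh _).zero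
      (fun r hr => by
        have := le_sh hg (δ k) hr
        have := hgc r hr
        linarith) E b hbt hEb.le
    refine ⟨K, hK1, hK2, ?_⟩
    refine sf_mono (sf_union hE (sf_countable hK3)) ?_
    intro p hp
    by_cases h : p ∈ ⋃ i, E i
    · exact Or.inr ⟨h, hp⟩
    · exact Or.inl ⟨mem_univ _, h⟩
  choose K hK1 hK2 hK3 using hcov
  -- limits along an ultrafilter
  let U : Ultrafilter ℕ := hyperfilter ℕ
  have hU : (U : Filter ℕ) ≤ atTop := by
    rw [← Nat.cofinite_eq_atTop]; exact hyperfilter_le_cofinite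
  have hlim : ∀ j, ∃ L : NonemptyCompacts M, Tendsto (fun k => K k j) U (𝓝 L) := by
    intro j
    obtain ⟨L, -, hL⟩ := isCompact_univ.ultrafilter_le_nhds (U.map (fun k => K k j)) (by simp)
    exact ⟨L, hL⟩
  choose L hL using hlim
  have hdiam : ∀ j, Tendsto (fun k => diam (K k j : Set M)) U (𝓝 (diam (L j : Set M))) :=
    fun j => (continuous_diam.tendsto (L j)).comp (hL j)
  have hgl : ∀ j, Tendsto (fun k => sh g (δ k) (diam (K k j : Set M))) U
      (𝓝 (g (diam (L j : Set M)))) := by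
    intro j
    have hgd : Tendsto (fun k => g (diam (K k j : Set M))) U (𝓝 (g (diam (L j : Set M)))) :=
      (hg.cont.tendsto _).comp (hdiam j)
    rcases (diam_nonneg (s := (L j : Set M))).eq_or_lt with h0 | hpos
    · rw [← h0, hg.zero] at hgd ⊢
      exact squeeze_zero (fun k => (hg.sh _).nonneg diam_nonneg)
        (fun k => sh_le hg _ diam_nonneg) hgd
    · refine hgd.congr' ?_
      have e1 : ∀ᶠ k in (U : Filter ℕ), diam (L j : Set M) / 2 < diam (K k j : Set M) :=
        (hdiam j).eventually (lt_mem_nhds (by linarith))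
      have e2 : ∀ᶠ k in (U : Filter ℕ), δ k < diam (L j : Set M) / 2 :=
        (hδ0.mono_left hU).eventually (gt_mem_nhds (by linarith))
      filter_upwards [e1, e2] with k h1 h2
      exact (sh_eq (hδ k) (h2.trans h1).le).symm
  have hsumL : ∑' j, ENNReal.ofReal (g (diam (L j : Set M))) ≤ b := by
    refine ENNReal.tsum_le_of_sum_range_le fun n => ?_
    have ht : Tendsto (fun k => ∑ j ∈ Finset.range n,
        ENNReal.ofReal (sh g (δ k) (diam (K k j : Set M)))) U
        (𝓝 (∑ j ∈ Finset.range n, ENNReal.ofReal (g (diam (L j : Set M))))) :=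
      tendsto_finsetSum _ fun j _ => ENNReal.tendsto_ofReal (hgl j)
    exact le_of_tendsto' ht fun k => (ENNReal.sum_le_tsum _).trans (hK1 k)
  -- sum bound of diameters
  have hsumK : ∀ k, ∑' j, ENNReal.ofReal (diam (K k j : Set M)) ≤ ENNReal.ofReal (2 / c) * b := by
    intro k
    calc ∑' j, ENNReal.ofReal (diam (K k j : Set M))
        ≤ ∑' j, ENNReal.ofReal (2 / c) * ENNReal.ofReal (sh g (δ k) (diam (K k j : Set M))) := by
          refine ENNReal.tsum_le_tsum fun j => ?_
          rw [← ENNReal.ofReal_mul (by positivity)]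
          refine ENNReal.ofReal_le_ofReal ?_
          have h1 := le_sh hg (δ k) (diam_nonneg (s := (K k j : Set M)))
          have h2 := hgc _ (diam_nonneg (s := (K k j : Set M)))
          rw [div_mul_eq_mul_div, le_div_iff₀ hc]
          linarith
      _ = ENNReal.ofReal (2 / c) * ∑' j, ENNReal.ofReal (sh g (δ k) (diam (K k j : Set M))) :=
          ENNReal.tsum_mul_left
      _ ≤ _ := by gcongr; exact hK1 k
  -- enlarge
  have hfinal : ∀ ε : ℝ≥0, 0 < ε → W g (univ : Set M) ≤ b + ε := by
    intro ε hε
    obtain ⟨ε', hε', hsum⟩ := ENNReal.exists_pos_sum_of_countable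
      (ENNReal.coe_ne_zero.2 hε.ne') ℕ
    have hη : ∀ j, ∃ η : ℝ, 0 < η ∧
        g (diam (thickening η (L j : Set M))) ≤ g (diam (L j : Set M)) + ε' j := by
      intro j
      have hc1 := Metric.continuousAt_iff.1 (hg.cont.continuousAt (x := diam (L j : Set M)))
        (ε' j) (by exact_mod_cast hε' j)
      obtain ⟨ρ, hρ, hρg⟩ := hc1
      refine ⟨ρ / 4, by positivity, ?_⟩
      have h1 := diam_thickening_le (L j : Set M) (ε := ρ / 4) (by positivity)
      have h2 : diam (L j : Set M) ≤ diam (thickening (ρ / 4) (L j : Set M)) :=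
        diam_mono (self_subset_thickening (by positivity) _) isBounded_of_compactSpace
      have h3 := hρg (x := diam (thickening (ρ / 4) (L j : Set M))) (by
        rw [Real.dist_eq, abs_lt]; constructor <;> linarith)
      rw [Real.dist_eq, abs_lt] at h3
      linarith [h3.2]
    choose η hη0 hηg using hη
    let V : ℕ → Set M := fun j => thickening (η j) (L j : Set M)
    let S : Set M := ⋃ k, (⋃ j, (K k j : Set M))ᶜ
    have hS : IsH1SigmaFinite S := sf_iUnion hK3
    have hT : μH[1] ((⋃ j, V j)ᶜ \ S) < ⊤ := by
      have hk : ∀ J : ℕ, ∃ k, ∀ j < J, (K k j : Set M) ⊆ V j := by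
        intro J
        have : ∀ᶠ k in (U : Filter ℕ), ∀ j ∈ Finset.range J, (K k j : Set M) ⊆ V j := by
          rw [Filter.eventually_all_finset]
          intro j _
          filter_upwards [(hL j).eventually (ball_mem_nhds _ (hη0 j))] with k hk
          exact hd_subset hk
        obtain ⟨k, hk⟩ := this.exists
        exact ⟨k, fun j hj => hk j (Finset.mem_range.2 hj)⟩
      choose k hk using hk
      have hed : ∀ Q : NonemptyCompacts M, ediam (Q : Set M) = ENNReal.ofReal (diam (Q : Set M)) :=
        fun Q => (ENNReal.ofReal_toReal (Q.isCompact.isBounded.ediam_ne_top)).symm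
      have hle := Measure.hausdorffMeasure_le_liminf_tsum (X := M) (ι := fun _ : ℕ => ℕ) 1
        ((⋃ j, V j)ᶜ \ S) (l := atTop)
        (fun J : ℕ => ENNReal.ofReal ((b.toReal / (c / 2)) * (1 / ((J : ℝ) + 1))))
        (by
          have := (tendsto_one_div_add_atTop_nhds_zero_nat (𝕜 := ℝ)).const_mul (b.toReal / (c / 2))
          have := ENNReal.tendsto_ofReal this
          simpa using this)
        (fun J i => (K (k J) (J + i) : Set M))
        (Eventually.of_forall fun J i => by
          rw [hed]
          refine ENNReal.ofReal_le_ofReal ?_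
          have h1 := hK2 (k J) (J + i)
          rw [mul_one_div, le_div_iff₀ (by positivity)]
          refine le_trans ?_ h1
          rw [mul_comm]
          gcongr
          push_cast
          linarith [(Nat.cast_nonneg i : (0:ℝ) ≤ i)])
        (Eventually.of_forall fun J p hp => by
          have hpS : p ∈ ⋃ j, (K (k J) j : Set M) := by
            by_contra hne
            exact hp.2 (mem_iUnion.2 ⟨k J, hne⟩)
          obtain ⟨j, hj⟩ := mem_iUnion.1 hpS
          have hJ : J ≤ j := by
            by_contra hlt
            exact hp.1 (mem_iUnion.2 ⟨j, hk J j (not_le.1 hlt) hj⟩)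
          refine mem_iUnion.2 ⟨j - J, ?_⟩
          rwa [Nat.add_sub_cancel' hJ])
      refine hle.trans_lt (lt_of_le_of_lt (b := ENNReal.ofReal (2 / c) * b) ?_
        (ENNReal.mul_lt_top ENNReal.ofReal_lt_top hbt.lt_top))
      refine (liminf_le_liminf (v := fun _ => ENNReal.ofReal (2 / c) * b)
        (Eventually.of_forall fun J => ?_)).trans (by simp)
      simp only [ENNReal.rpow_one]
      refine le_trans ?_ (hsumK (k J))
      simp only [hed]
      exact ENNReal.tsum_comp_le_tsum_of_injective (add_right_injective J)
        (fun j => ENNReal.ofReal (diam (K (k J) j : Set M)))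
    have hV : IsH1SigmaFinite ((univ : Set M) \ ⋃ j, V j) := by
      refine sf_mono (sf_union hS (sf_of_finite hT)) ?_
      intro p hp
      by_cases h : p ∈ S
      · exact Or.inl h
      · exact Or.inr ⟨hp.2, h⟩
    calc W g (univ : Set M) ≤ ∑' j, ENNReal.ofReal (g (diam (V j))) := iInf₂_le V hV
      _ ≤ ∑' j, (ENNReal.ofReal (g (diam (L j : Set M))) + ε' j) := by
          refine ENNReal.tsum_le_tsum fun j => ?_
          refine (ENNReal.ofReal_le_ofReal (hηg j)).trans ?_
          refine ENNReal.ofReal_add_le.trans ?_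
          rw [ENNReal.ofReal_coe_nnreal]
      _ = _ := ENNReal.tsum_add
      _ ≤ b + ε := add_le_add hsumL hsum.le
  exact absurd (ENNReal.le_of_forall_pos_le_add fun ε hε _ => hfinal ε hε) (not_le.2 hb)

end main
end BTArc

namespace BTArc

section final
variable {M : Type*} [MetricSpace M] [MeasurableSpace M] [BorelSpace M]

lemma W_mono_set (g : ℝ → ℝ) {S T : Set M} (h : S ⊆ T) : W g S ≤ W g T :=
  le_iInf₂ fun E hE => iInf₂_le E (sf_mono hE (diff_subset_diff_left h))

lemma W_mono_fun {g g' : ℝ → ℝ} (h : ∀ r, 0 ≤ r → g r ≤ g' r) (S : Set M) : W g S ≤ W g' S :=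
  le_iInf₂ fun E hE => (iInf₂_le E hE).trans
    (ENNReal.tsum_le_tsum fun _ => ENNReal.ofReal_le_ofReal (h _ diam_nonneg))

lemma W_union (g : ℝ → ℝ) (S I : Set M) :
    W g (S ∪ I) ≤ W g S + ENNReal.ofReal (g (diam I)) := by
  unfold W
  simp only [ENNReal.iInf_add]
  refine le_iInf₂ fun E hE => ?_
  let E' : ℕ → Set M := fun n => Nat.casesOn n I E
  refine (iInf₂_le E' (sf_mono hE ?_)).trans ?_
  · rintro p ⟨hp, hpE⟩
    have h0 : p ∉ I := fun h => hpE (mem_iUnion.2 ⟨0, h⟩)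
    refine ⟨hp.resolve_right h0, fun h => ?_⟩
    obtain ⟨i, hi⟩ := mem_iUnion.1 h
    exact hpE (mem_iUnion.2 ⟨i + 1, hi⟩)
  · rw [tsum_eq_zero_add' ENNReal.summable, add_comm]
    exact le_rfl

lemma W_singleton {g : ℝ → ℝ} (hg : g 0 = 0) {S : Set M} (hS : S.Countable) : W g S = 0 := by
  have h1 : W g S ≤ ∑' _ : ℕ, ENNReal.ofReal (g (diam (∅ : Set M))) :=
    iInf₂_le (fun _ : ℕ => (∅ : Set M)) (sf_mono (sf_countable hS) diff_subset)
  refine le_antisymm (h1.trans ?_) zero_le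
  simp [hg]

lemma le_W_id [CompactSpace M] :
    (⨅ (A : Set M) (_ : IsH1SigmaFinite Aᶜ), hausdorffContent A) ≤ W id (univ : Set M) := by
  refine le_iInf₂ fun E hE => ?_
  refine (iInf₂_le (⋃ i, E i) (by rwa [compl_eq_univ_diff])).trans ?_
  have h1 : hausdorffContent (⋃ i, E i) ≤ ∑' i, ediam (E i) := iInf₂_le E (Subset.refl _)
  refine h1.trans (le_of_eq (tsum_congr fun i => ?_))
  exact (ENNReal.ofReal_toReal (isBounded_of_compactSpace (s := E i)).ediam_ne_top).symm

lemma adm_id : Adm id := ⟨continuous_id, rfl, 1, one_pos, fun r _ => by simp⟩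

lemma exists_seq [CompactSpace M] [Nonempty M] {a : ℝ≥0∞} (ha : a < W id (univ : Set M)) :
    ∃ g : ℕ → ℝ → ℝ, (∀ n, Adm (g n)) ∧ (∀ n, a < W (g n) (univ : Set M)) ∧ g 0 = id ∧
      (∀ m n, m ≤ n → ∀ r, 0 ≤ r → g n r ≤ g m r) ∧
      (∀ n, ∃ ρ : ℝ, 0 < ρ ∧ ∀ r, 0 ≤ r → r ≤ ρ → g n r ≤ r * (1/2) ^ n) := by
  choose δ hδ hδW using fun g : {g : ℝ → ℝ // Adm g ∧ a < W g (univ : Set M)} => step g.2.1 g.2.2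
  let G : ℕ → {g : ℝ → ℝ // Adm g ∧ a < W g (univ : Set M)} := fun n =>
    Nat.rec ⟨id, adm_id, ha⟩ (fun _ g => ⟨sh g.1 (δ g), g.2.1.sh _, hδW g⟩) n
  have hG : ∀ n, (G (n + 1)).1 = sh (G n).1 (δ (G n)) := fun n => rfl
  refine ⟨fun n => (G n).1, fun n => (G n).2.1, fun n => (G n).2.2, rfl, ?_, ?_⟩
  · intro m n hmn r hr
    induction n, hmn using Nat.le_induction with
    | base => exact le_rfl
    | succ n hmn ih =>
      refine le_trans ?_ ih
      simp only [hG]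
      exact sh_le (G n).2.1 _ hr
  · intro n
    induction n with
    | zero => exact ⟨1, one_pos, fun r _ _ => by simp [G]⟩
    | succ n ih =>
      obtain ⟨ρ, hρ, h⟩ := ih
      refine ⟨min ρ (δ (G n) / 2), lt_min hρ (half_pos (hδ _)), fun r hr hrρ => ?_⟩
      simp only
      rw [hG, sh_small (hδ _) (hrρ.trans (min_le_right _ _)), pow_succ]
      have := h r hr (hrρ.trans (min_le_left _ _))
      linarith

lemma lower (h : Set.Icc (0:ℝ) 1 ≃ₜ M)
    (hbt : ∀ s t u : Set.Icc (0:ℝ) 1, s ≤ t → t ≤ u →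
      max (dist (h s) (h t)) (dist (h t) (h u)) ≤ dist (h s) (h u)) {a : ℝ≥0∞}
    (ha : a < W id (univ : Set M)) :
    ∃ f : M → ℝ, LipschitzWith 1 f ∧ LocallyFlat f ∧ a ≤ ENNReal.ofReal |f (h 1) - f (h 0)| := by
  have : CompactSpace M := h.compactSpace
  have : Nonempty M := ⟨h 0⟩
  obtain ⟨g, hadm, hW, hg0, hanti, hflat⟩ := exists_seq ha
  let F : Icc (0:ℝ) 1 → ℝ≥0∞ := fun t => ⨅ n, W (g n) (h '' Iic t)
  have hmono : ∀ s t, s ≤ t → F s ≤ F t := fun s t hst =>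
    iInf_mono fun n => W_mono_set _ (image_mono (Iic_subset_Iic.2 hst))
  have hdiam : ∀ s t, s ≤ t → diam (h '' Icc s t) = dist (h s) (h t) := by
    intro s t hst
    apply le_antisymm
    · refine diam_le_of_forall_dist_le dist_nonneg ?_
      have key : ∀ u v, s ≤ u → u ≤ v → v ≤ t → dist (h u) (h v) ≤ dist (h s) (h t) := by
        intro u v hu huv hv
        have h1 := (le_max_right _ _).trans (hbt s u v hu huv)
        have h2 := (le_max_left _ _).trans (hbt s v t (hu.trans huv) hv)
        exact h1.trans h2
      rintro _ ⟨u, hu, rfl⟩ _ ⟨v, hv, rfl⟩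
      rcases le_total u v with huv | huv
      · exact key u v hu.1 huv hv.2
      · rw [dist_comm]; exact key v u hv.1 huv hu.2
    · exact dist_le_diam_of_mem isBounded_of_compactSpace
        (mem_image_of_mem h (left_mem_Icc.2 hst)) (mem_image_of_mem h (right_mem_Icc.2 hst))
  have hinc : ∀ k s t, s ≤ t → F t ≤ F s + ENNReal.ofReal (g k (dist (h s) (h t))) := by
    intro k s t hst
    simp only [F]
    rw [ENNReal.iInf_add]
    refine le_iInf fun n => ?_
    refine (iInf_le _ (max n k)).trans ?_
    have hsub : h '' Iic t ⊆ h '' Iic s ∪ h '' Icc s t := by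
      rw [← image_union]
      refine image_mono fun u hu => ?_
      rcases le_total u s with hus | hus
      · exact Or.inl hus
      · exact Or.inr ⟨hus, hu⟩
    refine (W_mono_set _ hsub).trans ((W_union _ _ _).trans ?_)
    rw [hdiam s t hst]
    exact add_le_add (W_mono_fun (hanti n _ (le_max_left _ _)) _)
      (ENNReal.ofReal_le_ofReal (hanti k _ (le_max_right _ _) _ dist_nonneg))
  have hF0 : F 0 = 0 := by
    refine le_antisymm ((iInf_le _ 0).trans ?_) zero_le
    rw [W_singleton (hadm 0).zero]
    refine Set.Subsingleton.countable (Set.Subsingleton.image ?_ _)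
    intro u hu v hv
    have hu' : u = 0 := le_antisymm hu u.2.1
    have hv' : v = 0 := le_antisymm hv v.2.1
    rw [hu', hv']
  have hFtop : ∀ t, F t ≠ ⊤ := by
    intro t
    have := hinc 0 0 t t.2.1
    rw [hF0, zero_add] at this
    exact (this.trans_lt ENNReal.ofReal_lt_top).ne
  have hF1 : a ≤ F 1 := by
    refine le_iInf fun n => ?_
    have : h '' Iic 1 = univ := by
      rw [eq_univ_iff_forall]
      intro p
      exact ⟨h.symm p, (h.symm p).2.2, by simp⟩
    rw [this]
    exact (hW n).le
  let f : M → ℝ := fun p => (F (h.symm p)).toReal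
  have hreal : ∀ k s t, s ≤ t → |(F s).toReal - (F t).toReal| ≤ g k (dist (h s) (h t)) := by
    intro k s t hst
    have h1 : (F s).toReal ≤ (F t).toReal := ENNReal.toReal_mono (hFtop t) (hmono s t hst)
    have hgn : 0 ≤ g k (dist (h s) (h t)) := (hadm k).nonneg dist_nonneg
    have h2 := ENNReal.toReal_mono (ENNReal.add_ne_top.2 ⟨hFtop s, ENNReal.ofReal_ne_top⟩)
      (hinc k s t hst)
    rw [ENNReal.toReal_add (hFtop s) ENNReal.ofReal_ne_top, ENNReal.toReal_ofReal hgn] at h2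
    rw [abs_le]
    constructor <;> linarith
  have hf : ∀ k p q, |f p - f q| ≤ g k (dist p q) := by
    intro k p q
    rcases le_total (h.symm p) (h.symm q) with hpq | hpq
    · simpa using hreal k _ _ hpq
    · rw [abs_sub_comm, dist_comm]
      simpa using hreal k _ _ hpq
  refine ⟨f, ?_, ?_, ?_⟩
  · refine LipschitzWith.of_dist_le_mul fun p q => ?_
    have := hf 0 p q
    rw [hg0] at this
    simpa [Real.dist_eq] using this
  · intro p ε hε
    obtain ⟨n, hn⟩ := exists_pow_lt_of_lt_one hε (by norm_num : (1/2 : ℝ) < 1)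
    obtain ⟨ρ, hρ, hr⟩ := hflat n
    refine ⟨ρ / 2, by positivity, fun u v hu hv => ?_⟩
    have huv : dist u v ≤ ρ := by
      have := dist_triangle_right u v p
      linarith
    refine (hf n u v).trans ((hr _ dist_nonneg huv).trans ?_)
    rw [mul_comm]
    exact mul_le_mul_of_nonneg_right hn.le dist_nonneg
  · simp only [f, Homeomorph.symm_apply_apply]
    rw [hF0, ENNReal.toReal_zero, sub_zero, abs_of_nonneg ENNReal.toReal_nonneg,
      ENNReal.ofReal_toReal (hFtop 1)]
    exact hF1

end final
end BTArc

/-- For a 1-bounded turning arc `M` with endpoints `x = h 0`, `y = h 1`, the supremum of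
`|f y - f x|` over all 1-Lipschitz locally flat `f : M → ℝ` equals the infimum of
`H¹_∞(A)` over all `A ⊆ M` whose complement is `H¹`-σ-finite. -/
theorem sup_locallyFlat_eq_inf_content_bounded_turning_arc
    {M : Type*} [MetricSpace M] [MeasurableSpace M] [BorelSpace M]
    (h : Set.Icc (0:ℝ) 1 ≃ₜ M)
    (hbt : ∀ s t u : Set.Icc (0:ℝ) 1, s ≤ t → t ≤ u →
      max (dist (h s) (h t)) (dist (h t) (h u)) ≤ dist (h s) (h u))
    (x y : M) (hx : x = h ⟨0, by norm_num⟩) (hy : y = h ⟨1, by norm_num⟩) :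
    (⨆ (f : M → ℝ) (_ : LipschitzWith 1 f ∧ LocallyFlat f),
        ENNReal.ofReal |f y - f x|) =
      ⨅ (A : Set M) (_ : IsH1SigmaFinite Aᶜ), hausdorffContent A := by
  have : CompactSpace M := h.compactSpace
  have : ConnectedSpace M := h.surjective.connectedSpace h.continuous
  apply le_antisymm
  · exact iSup₂_le fun f hf => le_iInf₂ fun A hA => BTArc.upper hf.1 hf.2 hA x y
  · refine le_of_forall_lt fun a ha => ?_
    obtain ⟨b, hab, hb⟩ := exists_between ha
    obtain ⟨f, hf1, hf2, hfb⟩ := BTArc.lower h hbt (hb.trans_le BTArc.le_W_id)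
    subst hx hy
    exact hab.trans_le (hfb.trans (le_iSup₂_of_le f ⟨hf1, hf2⟩ le_rfl))
end
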